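/- arXiv:0911.3712 — 2 statements merged into one kernel-verified Lean document; each statement's English description precedes it below -/
import Mathlib

section
/- For every constant c > 0 and every k ∈ ℕ there exists n₀ such that for all n ≥ n₀ and every integer ℓ with c·log₂ n ≤ ℓ ≤ n/2, every extension of P_match(ℓ,n) that is isometry-symmetric with respect to S_n (acting by permuting the nodes of K_n) has size greater than n^k. In particular, for c·log₂ n ≤ ℓ ≤ n/2 there is no symmetric extended formulation of P_match(ℓ,n) of size polynomial in n. -/
open scoped BigOperators
open Classical in
noncomputable section

/-- Edges of the complete graph `K_n` on the node set `Fin n`. -/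
abbrev Edge (n : ℕ) := {e : Sym2 (Fin n) // ¬ e.IsDiag}

def edgeMap {n : ℕ} (π : Equiv.Perm (Fin n)) (e : Edge n) : Edge n :=
  ⟨Sym2.map π e.1, by rw [Sym2.isDiag_map (Equiv.injective π)]; exact e.2⟩

/-- Action of a node permutation on vectors indexed by edges:
`(π.x)_{{v,w}} = x_{{π⁻¹ v, π⁻¹ w}}`. -/
def edgeAction {n : ℕ} (π : Equiv.Perm (Fin n)) (x : Edge n → ℝ) : Edge n → ℝ :=
  fun e => x (edgeMap π⁻¹ e)

/-- A matching: a set of pairwise node-disjoint edges. -/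
def IsMatching {n : ℕ} (M : Finset (Edge n)) : Prop :=
  ∀ e ∈ M, ∀ f ∈ M, e ≠ f → ∀ v : Fin n, ¬(v ∈ e.1 ∧ v ∈ f.1)

/-- Characteristic vector of a set of edges. -/
def charVec {n : ℕ} (M : Finset (Edge n)) : Edge n → ℝ :=
  fun e => if e ∈ M then 1 else 0

/-- `P_match(ℓ,n)`: convex hull of characteristic vectors of size-`ℓ` matchings of `K_n`. -/
def matchingPolytope (n ℓ : ℕ) : Set (Edge n → ℝ) :=
  convexHull ℝ {x | ∃ M : Finset (Edge n), IsMatching M ∧ M.card = ℓ ∧ x = charVec M}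

/-! ### Part 1 : subgroups of small index -/

/-- Flip the second coordinates according to `S`. -/
def flipPerm {t : ℕ} (S : Fin t → Bool) : Equiv.Perm (Fin t × Bool) where
  toFun x := (x.1, xor x.2 (S x.1))
  invFun x := (x.1, xor x.2 (S x.1))
  left_inv x := by ext <;> simp
  right_inv x := by ext <;> simp

lemma gl_pigeon {α ι : Type*} [Fintype α] [DecidableEq α] [Fintype ι]
    (H : Subgroup (Equiv.Perm α)) (c : Equiv.Perm α → ι)
    (hc : ∀ π σ, c π = c σ → π * σ⁻¹ ∈ H) {t : ℕ} (ht : Fintype.card ι < 2 ^ t)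
    (f : Fin t × Bool → α) (hf : Function.Injective f) :
    ∃ g ∈ H, ∃ D : Fin t → Bool, (∃ i, D i = true) ∧
      (∀ i b, g (f (i, b)) = f (i, xor b (D i))) ∧ ∀ x, x ∉ Set.range f → g x = x := by
  classical
  obtain ⟨S, S', hne, he⟩ := Fintype.exists_ne_map_eq_of_card_lt
    (fun S : Fin t → Bool => c ((flipPerm S).viaEmbedding ⟨f, hf⟩)) (by simpa using ht)
  have h1 : ∀ (S : Fin t → Bool) i b,
      (flipPerm S).viaEmbedding ⟨f, hf⟩ (f (i, b)) = f (i, xor b (S i)) := by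
    intro S i b
    have := Equiv.Perm.viaEmbedding_apply (flipPerm S) ⟨f, hf⟩ (i, b)
    simpa [flipPerm] using this
  have h2 : ∀ (S : Fin t → Bool) x, x ∉ Set.range f →
      (flipPerm S).viaEmbedding ⟨f, hf⟩ x = x := by
    intro S x hx
    exact Equiv.Perm.viaEmbedding_apply_of_notMem (flipPerm S) ⟨f, hf⟩ x hx
  refine ⟨_, hc _ _ he, fun i => xor (S i) (S' i), ?_, ?_, ?_⟩
  · by_contra hcon
    push Not at hcon
    apply hne
    funext i
    have := hcon i
    revert this
    cases S i <;> cases S' i <;> simp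
  · intro i b
    rw [Equiv.Perm.mul_apply]
    have : ((flipPerm S').viaEmbedding ⟨f, hf⟩)⁻¹ (f (i, b)) = f (i, xor b (S' i)) := by
      rw [Equiv.Perm.inv_eq_iff_eq, h1]
      simp
    rw [this, h1]
    congr 2
    show xor (xor b (S' i)) (S i) = xor b (xor (S i) (S' i))
    cases b <;> cases S i <;> cases S' i <;> rfl
  · intro x hx
    rw [Equiv.Perm.mul_apply]
    have : ((flipPerm S').viaEmbedding ⟨f, hf⟩)⁻¹ x = x := by
      rw [Equiv.Perm.inv_eq_iff_eq, h2 _ _ hx]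
    rw [this, h2 _ _ hx]

/-- The three-cycle `a → b → c → a` belongs to `H`. -/
def Cyc {α : Type*} [DecidableEq α] (H : Subgroup (Equiv.Perm α)) (a b c : α) : Prop :=
  a ≠ b ∧ b ≠ c ∧ a ≠ c ∧ Equiv.swap a b * Equiv.swap b c ∈ H

section CycLemmas
variable {α : Type*} [DecidableEq α] {H : Subgroup (Equiv.Perm α)}

lemma Cyc.conj {a b c : α} (h : Cyc H a b c) {g : Equiv.Perm α} (hg : g ∈ H) :
    Cyc H (g a) (g b) (g c) := by
  obtain ⟨h1, h2, h3, h4⟩ := h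
  refine ⟨g.injective.ne h1, g.injective.ne h2, g.injective.ne h3, ?_⟩
  have : Equiv.swap (g a) (g b) * Equiv.swap (g b) (g c)
      = g * (Equiv.swap a b * Equiv.swap b c) * g⁻¹ := by
    rw [Equiv.swap_apply_apply, Equiv.swap_apply_apply]
    group
  rw [this]
  exact H.mul_mem (H.mul_mem hg h4) (H.inv_mem hg)

lemma Cyc.rot {a b c : α} (h : Cyc H a b c) : Cyc H b c a := by
  obtain ⟨h1, h2, h3, h4⟩ := h
  refine ⟨h2, h3.symm, h1.symm, ?_⟩
  convert h4 using 1
  ext x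
  simp only [Equiv.Perm.mul_apply, Equiv.swap_apply_def]
  grind

lemma Cyc.rev {a b c : α} (h : Cyc H a b c) : Cyc H c b a := by
  obtain ⟨h1, h2, h3, h4⟩ := h
  refine ⟨h2.symm, h1.symm, h3.symm, ?_⟩
  have := H.inv_mem h4
  rwa [mul_inv_rev, Equiv.swap_inv, Equiv.swap_inv, Equiv.swap_comm b c, Equiv.swap_comm a b]
    at this

/-- a group element sending `a → b → c → a` and fixing the rest -/
lemma Cyc.elt {a b c : α} (h : Cyc H a b c) :
    ∃ g ∈ H, g a = b ∧ g b = c ∧ g c = a ∧ ∀ x, x ≠ a → x ≠ b → x ≠ c → g x = x := by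
  obtain ⟨h1, h2, h3, h4⟩ := h
  refine ⟨_, h4, ?_, ?_, ?_, ?_⟩
  · simp only [Equiv.Perm.mul_apply, Equiv.swap_apply_def]; grind
  · simp only [Equiv.Perm.mul_apply, Equiv.swap_apply_def]; grind
  · simp only [Equiv.Perm.mul_apply, Equiv.swap_apply_def]; grind
  · intro x
    simp only [Equiv.Perm.mul_apply, Equiv.swap_apply_def]; grind

/-- related points -/
def CRel (H : Subgroup (Equiv.Perm α)) (a b : α) : Prop := a = b ∨ ∃ c, Cyc H a b c

lemma CRel.symm {a b : α} (h : CRel H a b) : CRel H b a := by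
  rcases h with rfl | ⟨c, hc⟩
  · exact Or.inl rfl
  · exact Or.inr ⟨c, hc.rev.rot⟩

lemma CRel.conj {a b : α} (h : CRel H a b) {g : Equiv.Perm α} (hg : g ∈ H) :
    CRel H (g a) (g b) := by
  rcases h with rfl | ⟨c, hc⟩
  · exact Or.inl rfl
  · exact Or.inr ⟨_, hc.conj hg⟩

lemma CRel.trans {a b c : α} (h : CRel H a b) (h' : CRel H b c) : CRel H a c := by
  rcases h with rfl | ⟨x, hx⟩
  · exact h'
  rcases h' with rfl | ⟨y, hy⟩
  · exact Or.inr ⟨x, hx⟩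
  by_cases hac : a = c
  · exact Or.inl hac
  by_cases hay : a = y
  · subst hay
    exact Or.inr ⟨b, hy.rev⟩
  obtain ⟨g, hg, h1, h2, h3, h4⟩ := hy.elt
  have := hx.conj hg
  rw [h4 a hx.1 hac hay, h1] at this
  exact Or.inr ⟨_, this⟩

lemma Cyc.of_rel {a b c : α} (hab : CRel H a b) (hac : CRel H a c) (h1 : a ≠ b) (h2 : b ≠ c)
    (h3 : a ≠ c) : Cyc H a b c := by
  rcases hab with h | ⟨x, hx⟩
  · exact absurd h h1
  by_cases hxc : x = c
  · rwa [← hxc]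
  have hxa : CRel H x a := Or.inr ⟨b, hx.rot.rot⟩
  rcases hxa.trans hac with h | ⟨w, hw⟩
  · exact absurd h hxc
  by_cases hwa : w = a
  · subst hwa
    obtain ⟨g, hg, e1, e2, e3, e4⟩ := hw.rev.elt
    have := hx.conj hg
    rw [e1, e3, e4 b h1.symm h2 hx.2.1] at this
    exact this.rev
  by_cases hwb : w = b
  · subst hwb
    obtain ⟨g, hg, e1, e2, e3, e4⟩ := hw.rev.elt
    have := hx.conj hg
    rw [e1, e3, e4 a h1 h3 hx.2.2.1] at this
    exact this.rev.rot.rot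
  obtain ⟨g, hg, e1, e2, e3, e4⟩ := hw.elt
  have := hx.conj hg
  rwa [e1, e4 a hx.2.2.1 h3 (Ne.symm hwa), e4 b hx.2.1 h2 (Ne.symm hwb)] at this

/-- two involutions whose supports meet in a single point give a 3-cycle -/
lemma cyc_of_involutions {g h : Equiv.Perm α} (hg : g ∈ H) (hh : h ∈ H)
    (g2 : ∀ z, g (g z) = z) (h2 : ∀ z, h (h z) = z) (x : α) (gx : g x ≠ x) (hx : h x ≠ x)
    (hd : ∀ z, z ≠ x → g z = z ∨ h z = z) : Cyc H (g x) (h x) x := by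
  have hgx : h (g x) = g x := by
    rcases hd (g x) gx with e | e
    · rw [g2] at e; exact absurd e.symm gx
    · exact e
  have ghx : g (h x) = h x := by
    rcases hd (h x) hx with e | e
    · exact e
    · rw [h2] at e; exact absurd e.symm hx
  have hne : g x ≠ h x := by
    intro e
    rw [← e, g2] at ghx
    exact gx ghx.symm
  refine ⟨hne, hx, gx, ?_⟩
  have : Equiv.swap (g x) (h x) * Equiv.swap (h x) x = g * h * g * h := by
    ext w
    simp only [Equiv.Perm.mul_apply]
    by_cases w1 : w = x
    · subst w1
      rw [Equiv.swap_apply_right, Equiv.swap_apply_right, ghx, h2]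
    by_cases w2 : w = h x
    · subst w2
      rw [Equiv.swap_apply_left, Equiv.swap_apply_of_ne_of_ne gx.symm hx.symm, h2, hgx, g2]
    by_cases w3 : w = g x
    · subst w3
      rw [Equiv.swap_apply_of_ne_of_ne hne gx, Equiv.swap_apply_left, hgx, g2, ghx]
    rw [Equiv.swap_apply_of_ne_of_ne w2 w1, Equiv.swap_apply_of_ne_of_ne w3 w2]
    by_cases hw : h w = w
    · rw [hw]
      by_cases gw : g w = w
      · rw [gw, hw, gw]
      · have n1 : g w ≠ x := fun e => w3 (by rw [← e, g2])
        rcases hd (g w) n1 with e | e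
        · rw [g2] at e; exact absurd e.symm gw
        · rw [e, g2]
    · have n1 : h w ≠ x := fun e => w2 (by rw [← e, h2])
      have e1 : g (h w) = h w := by
        rcases hd (h w) n1 with e | e
        · exact e
        · rw [h2] at e; exact absurd e.symm hw
      have e2 : g w = w := by
        rcases hd w w1 with e | e
        · exact e
        · exact absurd e hw
      rw [e1, h2, e2]
  rw [this]
  exact H.mul_mem (H.mul_mem (H.mul_mem hg hh) hg) hh

end CycLemmas

/-- points outside a small exceptional set are moved by involutions of `H` supported on the
range of a given injection -/
lemma gl_line {α ι : Type*} [Fintype α] [DecidableEq α] [Fintype ι]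
    (H : Subgroup (Equiv.Perm α)) (c : Equiv.Perm α → ι)
    (hc : ∀ π σ, c π = c σ → π * σ⁻¹ ∈ H) {t m : ℕ} (ht : Fintype.card ι < 2 ^ t)
    (F : Fin m → α) (hF : Function.Injective F) :
    ∃ S : Finset (Fin m), S.card < 2 * t ∧ ∀ j, j ∉ S → ∃ g ∈ H, (∀ z, g (g z) = z) ∧
      g (F j) ≠ F j ∧ ∀ z, z ∉ Set.range F → g z = z := by
  classical
  refine ⟨Finset.univ.filter (fun j => ¬ ∃ g ∈ H, (∀ z, g (g z) = z) ∧
      g (F j) ≠ F j ∧ ∀ z, z ∉ Set.range F → g z = z), ?_, ?_⟩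
  · by_contra hcon
    rw [not_lt] at hcon
    set S := Finset.univ.filter (fun j => ¬ ∃ g ∈ H, (∀ z, g (g z) = z) ∧
      g (F j) ≠ F j ∧ ∀ z, z ∉ Set.range F → g z = z) with hS
    have : Fintype.card (Fin t × Bool) ≤ Fintype.card S := by
      simp [Fintype.card_prod]; omega
    obtain ⟨e⟩ := Function.Embedding.nonempty_of_card_le this
    have hinj : Function.Injective (fun x => F (e x).1) := by
      intro x y hxy
      exact e.injective (Subtype.ext (hF hxy))
    obtain ⟨g, hg, D, ⟨i, hi⟩, h1, h2⟩ := gl_pigeon H c hc ht _ hinj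
    have hmem := (e (i, false)).2
    apply (Finset.mem_filter.1 hmem).2
    refine ⟨g, hg, ?_, ?_, ?_⟩
    · intro z
      by_cases hz : z ∈ Set.range (fun x => F (e x).1)
      · obtain ⟨⟨i, b⟩, rfl⟩ := hz
        have a1 := h1 i b
        have a2 := h1 i (xor b (D i))
        simp only at a1 a2 ⊢
        rw [a1, a2]
        simp
      · rw [h2 z hz, h2 z hz]
    · have a1 := h1 i false
      simp only [hi] at a1
      rw [a1]
      intro h
      have := hinj h
      simp at this
    · intro z hz
      apply h2
      rintro ⟨x, rfl⟩
      exact hz ⟨_, rfl⟩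
  · intro j hj
    simpa using hj

lemma gl_grid {α ι : Type*} [Fintype α] [DecidableEq α] [Fintype ι]
    (H : Subgroup (Equiv.Perm α)) (c : Equiv.Perm α → ι)
    (hc : ∀ π σ, c π = c σ → π * σ⁻¹ ∈ H) {t m : ℕ} (ht : Fintype.card ι < 2 ^ t)
    (hm : 4 * t ≤ m) (hm0 : 0 < m)
    (F : Fin m × Fin m → α) (hF : Function.Injective F) :
    ∃ x y z : Fin m × Fin m, Cyc H (F x) (F y) (F z) := by
  classical
  have h1 := fun i => gl_line H c hc ht (fun j => F (i, j))
    (fun a b h => by simpa using hF h)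
  have h2 := fun j => gl_line H c hc ht (fun i => F (i, j))
    (fun a b h => by simpa using hF h)
  choose S hS hS' using h1
  choose T hT hT' using h2
  have key : ∃ i j, j ∉ S i ∧ i ∉ T j := by
    by_contra hcon
    push Not at hcon
    have hsub : (Finset.univ : Finset (Fin m × Fin m)) ⊆
        (Finset.univ.sigma S).image (fun x => (x.1, x.2)) ∪
        (Finset.univ.sigma T).image (fun x => (x.2, x.1)) := by
      rintro ⟨i, j⟩ -
      rw [Finset.mem_union]
      by_cases h : j ∈ S i
      · left
        exact Finset.mem_image.2 ⟨⟨i, j⟩, by simpa using h, rfl⟩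
      · right
        exact Finset.mem_image.2 ⟨⟨j, i⟩, by simpa using hcon i j h, rfl⟩
    have c1 := Finset.card_le_card hsub
    have c2 := (c1.trans (Finset.card_union_le _ _)).trans
      (add_le_add Finset.card_image_le Finset.card_image_le)
    rw [Finset.card_sigma, Finset.card_sigma] at c2
    have c3 : ∑ i, (S i).card ≤ ∑ _i : Fin m, (2 * t - 1) :=
      Finset.sum_le_sum (fun i _ => by have := hS i; omega)
    have c4 : ∑ i, (T i).card ≤ ∑ _i : Fin m, (2 * t - 1) :=
      Finset.sum_le_sum (fun i _ => by have := hT i; omega)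
    simp at c2 c3 c4
    have := hS ⟨0, hm0⟩
    have e : m * (2 * t - 1) + m * (2 * t - 1) < m * m := by
      rw [← mul_add]
      apply Nat.mul_lt_mul_of_pos_left _ hm0
      omega
    omega
  obtain ⟨i, j, hi, hj⟩ := key
  obtain ⟨g, hg, g2, gx, gs⟩ := hS' i j hi
  obtain ⟨h, hh, h2, hx, hs⟩ := hT' j i hj
  have hcyc := cyc_of_involutions hg hh g2 h2 (F (i, j)) gx hx (by
    intro z hz
    by_contra hcon
    push Not at hcon
    have a1 : z ∈ Set.range (fun j => F (i, j)) := by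
      by_contra h'; exact hcon.1 (gs z h')
    have a2 : z ∈ Set.range (fun i => F (i, j)) := by
      by_contra h'; exact hcon.2 (hs z h')
    obtain ⟨j', rfl⟩ := a1
    obtain ⟨i', hi'⟩ := a2
    have := hF hi'
    simp only [Prod.mk.injEq] at this
    apply hz
    rw [this.2])
  have b1 : g (F (i, j)) ∈ Set.range (fun j => F (i, j)) := by
    by_contra h'
    have := gs _ h'
    rw [g2] at this
    exact gx this.symm
  have b2 : h (F (i, j)) ∈ Set.range (fun i => F (i, j)) := by
    by_contra h'
    have := hs _ h'
    rw [h2] at this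
    exact hx this.symm
  obtain ⟨j', hj'⟩ := b1
  obtain ⟨i', hi'⟩ := b2
  exact ⟨(i, j'), (i', j), (i, j), by simpa only [hj', hi'] using hcyc⟩

/-- Extension of partial maps by products of colour preserving swaps. -/
lemma ext_swaps {K V C : Type*} [Finite K] [DecidableEq V] (color : V → C)
    (f f' : K → V) (hf : Function.Injective f) (hf' : Function.Injective f')
    (hcol : ∀ k, color (f k) = color (f' k)) (Z : Equiv.Perm V → Prop) (Z1 : Z 1)
    (Zs : ∀ ρ x y, x ≠ y → color x = color y → Z ρ → Z (Equiv.swap x y * ρ))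
    (Zc : ∀ ρ, Z ρ → ∀ v, color (ρ v) = color v) :
    ∃ ρ, Z ρ ∧ ∀ k, ρ (f k) = f' k := by
  classical
  have := Fintype.ofFinite K
  have key : ∀ S : Finset K, ∃ ρ, Z ρ ∧ ∀ k ∈ S, ρ (f k) = f' k := by
    intro S
    induction S using Finset.induction_on with
    | empty => exact ⟨1, Z1, by simp⟩
    | insert a S ha ih =>
      obtain ⟨ρ, hρ, h⟩ := ih
      by_cases he : ρ (f a) = f' a
      · refine ⟨ρ, hρ, ?_⟩
        intro k hk
        rcases Finset.mem_insert.1 hk with rfl | hk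
        · exact he
        · exact h k hk
      · refine ⟨Equiv.swap (ρ (f a)) (f' a) * ρ, Zs _ _ _ he ?_ hρ, ?_⟩
        · rw [Zc ρ hρ, hcol]
        intro k hk
        rcases Finset.mem_insert.1 hk with rfl | hk
        · simp
        · have hne : k ≠ a := fun e => ha (e ▸ hk)
          rw [Equiv.Perm.mul_apply, Equiv.swap_apply_of_ne_of_ne, h k hk]
          · exact fun e => hne (hf (ρ.injective e))
          · rw [h k hk]; exact fun e => hne (hf' e)
  obtain ⟨ρ, h1, h2⟩ := key Finset.univ
  exact ⟨ρ, h1, fun k => h2 k (Finset.mem_univ k)⟩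

lemma gl_main {α ι : Type*} [Fintype α] [DecidableEq α] [Fintype ι]
    (H : Subgroup (Equiv.Perm α)) (c : Equiv.Perm α → ι)
    (hc : ∀ π σ, c π = c σ → π * σ⁻¹ ∈ H) {t : ℕ} (ht : Fintype.card ι < 2 ^ t)
    (ht0 : 0 < t) (hn : 16 * t ^ 2 * (2 * t) < Fintype.card α) :
    ∃ U : Finset α, U.card < t ∧ (Fintype.card α).choose U.card ≤ Fintype.card ι ∧
      ∀ a b c, a ∉ U → b ∉ U → c ∉ U → a ≠ b → b ≠ c → a ≠ c → Cyc H a b c := by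
  classical
  let st : Setoid α := ⟨CRel H, fun a => Or.inl rfl, CRel.symm, CRel.trans⟩
  have hq : Fintype.card (Quotient st) ≤ 16 * t ^ 2 := by
    by_contra hcon
    push Not at hcon
    have : Fintype.card (Fin (4 * t) × Fin (4 * t)) ≤ Fintype.card (Quotient st) := by
      simp only [Fintype.card_prod, Fintype.card_fin]
      nlinarith
    obtain ⟨e⟩ := Function.Embedding.nonempty_of_card_le this
    obtain ⟨x, y, z, h⟩ := gl_grid H c hc ht le_rfl (by omega) (fun x => (e x).out)
      (fun a b h => e.injective (Quotient.out_injective h))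
    have h1 : (e x).out ≈ (e y).out := Or.inr ⟨_, h⟩
    have h2 := Quotient.out_equiv_out.1 h1
    exact h.1 (by simp only [h2])
  obtain ⟨q, hqq⟩ := Fintype.exists_lt_card_fiber_of_mul_lt_card
    (fun a : α => (Quotient.mk st a)) (n := 2 * t) (by
      exact lt_of_le_of_lt (Nat.mul_le_mul_right _ hq) hn)
  set X := Finset.univ.filter (fun a : α => Quotient.mk st a = q) with hX
  have hrel : ∀ a b, a ∈ X → (b ∈ X ↔ CRel H a b) := by
    intro a b ha
    have ha' : Quotient.mk st a = q := by simpa [hX] using ha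
    constructor
    · intro hb
      have hb' : Quotient.mk st b = q := by simpa [hX] using hb
      exact Quotient.exact (ha'.trans hb'.symm)
    · intro h
      have : Quotient.mk st a = Quotient.mk st b := Quotient.sound h
      simp [hX, ← this, ha']
  have hXc : (Xᶜ).card < t := by
    by_contra hcon
    push Not at hcon
    have i1 : Fintype.card (Fin t) ≤ Fintype.card X := by simp; omega
    have i2 : Fintype.card (Fin t) ≤ Fintype.card (Xᶜ : Finset α) := by
      rw [Fintype.card_coe, Fintype.card_fin]; exact hcon
    obtain ⟨e1⟩ := Function.Embedding.nonempty_of_card_le i1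
    obtain ⟨e2⟩ := Function.Embedding.nonempty_of_card_le i2
    let f : Fin t × Bool → α := fun x => if x.2 then (e2 x.1).1 else (e1 x.1).1
    have hne : ∀ i j, (e1 i).1 ≠ (e2 j).1 := by
      intro i j h
      have a1 := (e1 i).2
      have a2 := (e2 j).2
      rw [← h] at a2
      exact (Finset.mem_compl.1 a2) a1
    have hf : Function.Injective f := by
      rintro ⟨i, b⟩ ⟨j, b'⟩ h
      cases b <;> cases b' <;> simp [f] at h
      · simpa using h
      · exact absurd h (hne _ _)
      · exact absurd h.symm (hne _ _)
      · simpa using h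
    obtain ⟨g, hg, D, ⟨i, hi⟩, h1, h2⟩ := gl_pigeon H c hc ht f hf
    have : ∃ x ∈ X, x ∉ Finset.univ.image (fun i => (e1 i).1) := by
      by_contra h
      push Not at h
      have := Finset.card_le_card (show X ⊆ _ from h)
      have := this.trans Finset.card_image_le
      simp at this
      omega
    obtain ⟨x, hx, hx'⟩ := this
    have gx : g x = x := by
      apply h2
      rintro ⟨⟨j, b⟩, hj⟩
      cases b
      · exact hx' (Finset.mem_image.2 ⟨j, Finset.mem_univ _, by simpa [f] using hj⟩)
      · have := (e2 j).2
        simp [f] at hj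
        rw [hj] at this
        exact (Finset.mem_compl.1 this) hx
    have r1 : CRel H x (e1 i).1 := (hrel x _ hx).1 (e1 i).2
    have r2 := r1.conj hg
    have a1 := h1 i false
    simp [f, hi] at a1
    rw [gx, a1] at r2
    exact (Finset.mem_compl.1 (e2 i).2) ((hrel x _ hx).2 r2)
  have hcardX : X.card + (Xᶜ).card = Fintype.card α := Finset.card_add_card_compl X
  have hbig : 2 * (Xᶜ).card < Fintype.card α := by nlinarith
  have hpres : ∀ h ∈ H, ∀ y, h y ∈ X ↔ y ∈ X := by
    have h0 : ∀ h ∈ H, ∀ y ∈ X, h y ∈ X := by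
      intro h hh y hy
      have : ∃ x ∈ X, h x ∈ X := by
        by_contra hcon
        push Not at hcon
        have hsub : X.image h ⊆ Xᶜ := by
          intro z hz
          obtain ⟨w, hw, rfl⟩ := Finset.mem_image.1 hz
          exact Finset.mem_compl.2 (hcon w hw)
        have := Finset.card_le_card hsub
        rw [Finset.card_image_of_injective _ h.injective] at this
        omega
      obtain ⟨x, hx, hx'⟩ := this
      exact (hrel _ _ hx').2 (((hrel _ _ hx).1 hy).conj hh)
    intro h hh y
    refine ⟨fun hy => ?_, h0 h hh y⟩
    have := h0 h⁻¹ (H.inv_mem hh) _ hy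
    simpa using this
  refine ⟨Xᶜ, hXc, ?_, ?_⟩
  · have ex : ∀ S : Finset.powersetCard (Xᶜ).card (Finset.univ : Finset α),
        ∃ ρ : Equiv.Perm α, ∀ v, ρ v ∈ Xᶜ ↔ v ∈ S.1 := by
      rintro ⟨S, hS⟩
      have hS' := (Finset.mem_powersetCard.1 hS).2
      let e := Finset.equivOfCardEq hS'
      obtain ⟨ρ, -, hρ⟩ := ext_swaps (K := S) (V := α) (C := Unit) (fun _ => ())
        (fun k => k.1) (fun k => (e k).1) Subtype.val_injective
        (fun a b h => e.injective (Subtype.ext h)) (fun _ => rfl) (fun _ => True) trivial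
        (fun _ _ _ _ _ _ => trivial) (fun _ _ _ => rfl)
      refine ⟨ρ, fun v => ⟨fun hv => ?_, fun hv => ?_⟩⟩
      · have := hρ (e.symm ⟨ρ v, hv⟩)
        simp only [Equiv.apply_symm_apply] at this
        have := ρ.injective this
        rw [← this]
        exact (e.symm ⟨ρ v, hv⟩).2
      · rw [hρ ⟨v, hv⟩]
        exact (e ⟨v, hv⟩).2
    choose ρ hρ using ex
    have hinj : Function.Injective (fun S => c (ρ S)) := by
      intro S S' h
      have hh := hc _ _ h
      apply Subtype.ext
      ext v
      have a1 := hpres _ hh (ρ S' v)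
      simp only [Equiv.Perm.mul_apply, Equiv.Perm.coe_inv, Equiv.symm_apply_apply] at a1
      rw [← hρ S v, ← hρ S' v, Finset.mem_compl, Finset.mem_compl, a1]
    have := Fintype.card_le_of_injective _ hinj
    rwa [Fintype.card_coe, Finset.card_powersetCard, Finset.card_univ] at this
  · intro a b c ha hb hc' h1 h2 h3
    simp only [Finset.mem_compl, not_not] at ha hb hc'
    exact Cyc.of_rel ((hrel a b ha).1 hb) ((hrel a c ha).1 hc') h1 h2 h3

lemma choose_big (k n : ℕ) (hn : 2 ^ (k + 1) * (k + 1).factorial < n) (hn2 : 2 * k ≤ n) :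
    n ^ k < n.choose (k + 1) := by
  have h1 := Nat.pow_sub_le_descFactorial n (k + 1)
  rw [Nat.descFactorial_eq_factorial_mul_choose] at h1
  have h2 : n ^ (k + 1) ≤ 2 ^ (k + 1) * (n + 1 - (k + 1)) ^ (k + 1) := by
    rw [← mul_pow]
    apply Nat.pow_le_pow_left
    omega
  have h3 : n ^ (k + 1) ≤ 2 ^ (k + 1) * (k + 1).factorial * n.choose (k + 1) := by
    calc _ ≤ _ := h2
      _ ≤ 2 ^ (k + 1) * ((k + 1).factorial * n.choose (k + 1)) := Nat.mul_le_mul_left _ h1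
      _ = _ := by ring
  by_contra hcon
  push Not at hcon
  have h4 : n ^ (k + 1) ≤ 2 ^ (k + 1) * (k + 1).factorial * n ^ k :=
    h3.trans (Nat.mul_le_mul_left _ hcon)
  have hpos : 0 < n ^ k := Nat.pow_pos (by omega)
  have : n * n ^ k ≤ 2 ^ (k + 1) * (k + 1).factorial * n ^ k := by
    rw [pow_succ'] at h4; exact h4
  have := Nat.le_of_mul_le_mul_right this hpos
  omega

lemma choose_mono_half {n a b : ℕ} (hab : a ≤ b) (hb : b ≤ n / 2) :
    n.choose a ≤ n.choose b := by
  induction b, hab using Nat.le_induction with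
  | base => exact le_rfl
  | succ b h ih => exact (ih (by omega)).trans (Nat.choose_le_succ_of_lt_half_left (by omega))

lemma polylog_bound (k : ℕ) : ∃ n₀ : ℕ, ∀ n : ℕ, n₀ ≤ n →
    16 * (k * (Nat.log 2 n + 1) + 1) ^ 2 * (2 * (k * (Nat.log 2 n + 1) + 1)) < n := by
  have h := tendsto_pow_const_div_const_pow_of_one_lt 3 (r := (2 : ℝ)) (by norm_num)
  have h2 := h.eventually (gt_mem_nhds (show (0 : ℝ) < 1 / (32 * (2 * k + 1) ^ 3 + 1) by positivity))
  obtain ⟨L, hL⟩ := Filter.eventually_atTop.1 h2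
  refine ⟨2 ^ (L + 1), fun n hn => ?_⟩
  set l := Nat.log 2 n with hl
  have hn0 : n ≠ 0 := by
    have : 0 < 2 ^ (L + 1) := by positivity
    omega
  have hlL : L + 1 ≤ l := (Nat.le_log_iff_pow_le (by norm_num) hn0).2 hn
  have hln : 2 ^ l ≤ n := Nat.pow_log_le_self 2 hn0
  have h3 := hL l (by omega)
  rw [div_lt_div_iff₀ (by positivity) (by positivity)] at h3
  have h4 : (l : ℝ) ^ 3 * (32 * (2 * k + 1) ^ 3 + 1) < 2 ^ l := by linarith
  have h5 : l ^ 3 * (32 * (2 * k + 1) ^ 3 + 1) < 2 ^ l := by exact_mod_cast h4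
  have h6 : k * (l + 1) + 1 ≤ (2 * k + 1) * l := by nlinarith
  calc 16 * (k * (l + 1) + 1) ^ 2 * (2 * (k * (l + 1) + 1))
      = 32 * (k * (l + 1) + 1) ^ 3 := by ring
    _ ≤ 32 * ((2 * k + 1) * l) ^ 3 := by gcongr
    _ ≤ l ^ 3 * (32 * (2 * k + 1) ^ 3 + 1) := by
        have : 0 ≤ l ^ 3 := Nat.zero_le _
        nlinarith
    _ < 2 ^ l := h5
    _ ≤ n := hln

lemma gl_final (k : ℕ) : ∃ n₀ : ℕ, ∀ n : ℕ, n₀ ≤ n → ∀ (ι : Type) [Fintype ι]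
    (H : Subgroup (Equiv.Perm (Fin n))) (c : Equiv.Perm (Fin n) → ι),
    (∀ π σ, c π = c σ → π * σ⁻¹ ∈ H) → Fintype.card ι ≤ n ^ k →
    ∃ U : Finset (Fin n), U.card ≤ k ∧
      ∀ a b c, a ∉ U → b ∉ U → c ∉ U → a ≠ b → b ≠ c → a ≠ c → Cyc H a b c := by
  obtain ⟨n₁, h₁⟩ := polylog_bound k
  refine ⟨n₁ + 2 ^ (k + 1) * (k + 1).factorial + 2 * k + 2, ?_⟩
  intro n hn ι _ H c hc hcard
  set t := k * (Nat.log 2 n + 1) + 1 with ht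
  have hpoly := h₁ n (by omega)
  have h2t : n ^ k < 2 ^ t := by
    rw [ht, pow_succ, mul_comm k, pow_mul]
    have := Nat.pow_le_pow_left (Nat.lt_pow_succ_log_self (b := 2) (by norm_num) n).le k
    have hp : 0 < n ^ k := Nat.pow_pos (by omega)
    simp only [Nat.succ_eq_add_one] at this
    omega
  obtain ⟨U, hU1, hU2, hU3⟩ := gl_main H c hc (t := t) (lt_of_le_of_lt hcard h2t) (by omega)
    (by simpa using hpoly)
  refine ⟨U, ?_, hU3⟩
  by_contra hcon
  push Not at hcon
  rw [Fintype.card_fin] at hU2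
  have h5 : 2 * t ≤ n := by
    have : 1 ≤ t := by omega
    have : 1 ≤ 16 * t ^ 2 := by nlinarith
    nlinarith
  have h6 := choose_mono_half (n := n) (a := k + 1) (b := U.card) (by omega) (by omega)
  have h7 := choose_big k n (by omega) (by omega)
  omega


theorem small_eps {J : Type*} [Finite J] (a b : J → ℝ) (P : J → Prop) (h : ∀ j, P j → 0 < a j) :
    ∃ ε : ℝ, 0 < ε ∧ ∀ t : ℝ, |t| ≤ ε → ∀ j, P j → 0 < a j + t * b j := by
  have h1 : ∀ᶠ t in nhds (0:ℝ), ∀ j, P j → 0 < a j + t * b j := by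
    rw [Filter.eventually_all]
    intro j
    by_cases hp : P j
    · have hc : Continuous (fun t : ℝ => a j + t * b j) := by fun_prop
      have := (hc.tendsto 0).eventually (lt_mem_nhds (show 0 < a j + 0 * b j by simpa using h j hp))
      filter_upwards [this] with t ht _ using ht
    · exact Filter.Eventually.of_forall fun t hh => absurd hh hp
  rw [Metric.eventually_nhds_iff] at h1
  obtain ⟨ε, hε, h2⟩ := h1
  refine ⟨ε / 2, by linarith, fun t ht => h2 ?_⟩
  rw [Real.dist_eq, sub_zero]; linarith

theorem aff_line {V : Type*} [AddCommGroup V] [Module ℝ V] (h : V →ᵃ[ℝ] ℝ) (x y : V) (t : ℝ) :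
    h (AffineMap.lineMap x y t) = (1 - t) * h x + t * h y := by
  rw [AffineMap.apply_lineMap, AffineMap.lineMap_apply_ring]

theorem aff_move {V : Type*} [AddCommGroup V] [Module ℝ V] (h : V →ᵃ[ℝ] ℝ) (x y z : V) (t : ℝ) :
    h (t • (x -ᵥ y) +ᵥ z) = t * (h x - h y) + h z := by
  rw [AffineMap.map_vadd, map_smul, AffineMap.linearMap_vsub]
  simp

theorem facet_perm {V : Type*} [AddCommGroup V] [Module ℝ V] {J : Type*} [Finite J]
    (L : AffineSubspace ℝ V) (h : J → V →ᵃ[ℝ] ℝ) (q0 : V) (hq0 : q0 ∈ L) (hpos : ∀ j, 0 < h j q0)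
    (z : J → V) (hz : ∀ j, z j ∈ L) (hzn : ∀ j, h j (z j) < 0) (hzp : ∀ i j, i ≠ j → 0 ≤ h j (z i))
    (κ : V →ᵃ[ℝ] V) (hL : ∀ y ∈ L, κ y ∈ L) (hsurj : ∀ y ∈ L, ∃ x ∈ L, κ x = y)
    (hQ : ∀ y ∈ L, (∀ j, 0 ≤ h j (κ y)) ↔ (∀ j, 0 ≤ h j y)) :
    ∃ (τ : Equiv.Perm J) (c : J → ℝ), (∀ i, 0 < c i) ∧
      ∀ i, ∀ y ∈ L, h (τ i) (κ y) = c i * h i y := by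
  have key : ∀ i, ∃ j, ∃ c : ℝ, 0 < c ∧ ∀ y ∈ L, h j (κ y) = c * h i y := by
    intro i
    have hi1 := hzn i
    have hi2 := hpos i
    obtain ⟨t, ht0, ht1, ht⟩ : ∃ t : ℝ, 0 < t ∧ t < 1 ∧ (1 - t) * h i (z i) + t * h i q0 = 0 := by
      refine ⟨-h i (z i) / (h i q0 - h i (z i)), ?_, ?_, ?_⟩
      · apply div_pos <;> linarith
      · rw [div_lt_one] <;> linarith
      · have : h i q0 - h i (z i) ≠ 0 := by linarith
        field_simp
        ring
    set w := AffineMap.lineMap (z i) q0 t with hw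
    have hwL : w ∈ L := AffineMap.lineMap_mem t (hz i) hq0
    have hw0 : h i w = 0 := by rw [hw, aff_line]; exact ht
    have hwp : ∀ j, j ≠ i → 0 < h j w := by
      intro j hj
      rw [hw, aff_line]
      have := hzp i j hj.symm
      have h2 := hpos j
      have : 0 ≤ (1 - t) * h j (z i) := mul_nonneg (by linarith) this
      have : 0 < t * h j q0 := mul_pos ht0 h2
      linarith
    have hwQ : ∀ j, 0 ≤ h j w := by
      intro j
      by_cases hj : j = i
      · rw [hj, hw0]
      · exact (hwp j hj).le
    have hkw := (hQ w hwL).2 hwQ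
    obtain ⟨j, hj⟩ : ∃ j, h j (κ w) = 0 := by
      by_contra hne
      push Not at hne
      have hp : ∀ j, True → 0 < h j (κ w) := fun j _ => lt_of_le_of_ne (hkw j) (hne j).symm
      obtain ⟨ε, hε, h1⟩ := small_eps (fun j => h j (κ w)) (fun j => h j (κ (z i)) - h j (κ w))
        (fun _ => True) hp
      have h2 := h1 ε (abs_of_pos hε).le
      have h3 := (hQ (AffineMap.lineMap w (z i) ε) (AffineMap.lineMap_mem ε hwL (hz i))).1 (by
        intro j
        rw [AffineMap.apply_lineMap, aff_line]
        have := h2 j trivial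
        linarith) i
      rw [aff_line, hw0] at h3
      have := mul_neg_of_pos_of_neg hε hi1
      linarith
    have hvan : ∀ y ∈ L, h i y = 0 → h j (κ y) = 0 := by
      intro y hy hy0
      obtain ⟨ε, hε, h1⟩ := small_eps (fun j => h j w) (fun j => h j y - h j w)
        (fun j => j ≠ i) hwp
      have h2 : ∀ t : ℝ, |t| ≤ ε → 0 ≤ t * h j (κ y) := by
        intro t ht
        have h3 := (hQ (AffineMap.lineMap w y t) (AffineMap.lineMap_mem t hwL hy)).2 (by
          intro j'
          rw [aff_line]
          by_cases hj' : j' = i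
          · rw [hj', hw0, hy0]; simp
          · have := h1 t ht j' hj'
            linarith) j
        rw [AffineMap.apply_lineMap, aff_line, hj] at h3
        linarith
      have h3 := h2 ε (abs_of_pos hε).le
      have h4 := h2 (-ε) (by rw [abs_neg]; exact (abs_of_pos hε).le)
      have h5 : ε * h j (κ y) = 0 := by linarith
      rcases mul_eq_zero.1 h5 with h6 | h6
      · linarith
      · exact h6
    have hform : ∀ y ∈ L, h j (κ y) = (h j (κ q0) / h i q0) * h i y := by
      intro y hy
      have h1 := hvan ((-(h i y / h i q0)) • (q0 -ᵥ w) +ᵥ y) (L.smul_vsub_vadd_mem _ hq0 hwL hy) (by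
        rw [aff_move, hw0]; field_simp; ring)
      have h2 : h j (κ ((-(h i y / h i q0)) • (q0 -ᵥ w) +ᵥ y))
        = ((h j).comp κ) ((-(h i y / h i q0)) • (q0 -ᵥ w) +ᵥ y) := rfl
      rw [h2, aff_move] at h1
      simp only [AffineMap.coe_comp, Function.comp_apply, hj] at h1
      have h3 : h j (κ y) = h i y / h i q0 * h j (κ q0) := by linarith
      rw [h3]; ring
    refine ⟨j, _, ?_, hform⟩
    have h1 : 0 ≤ h j (κ q0) := (hQ q0 hq0).2 (fun j => (hpos j).le) j
    rcases h1.eq_or_lt with h2 | h2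
    · exfalso
      obtain ⟨x, hx, hxz⟩ := hsurj (z j) (hz j)
      have h3 := hform x hx
      rw [hxz, ← h2] at h3
      have := hzn j
      simp at h3
      linarith
    · exact div_pos h2 hi2
  choose τ c hc hτ using key
  have hinj : Function.Injective τ := by
    intro i i' hii
    by_contra hne
    have h1 := hτ i (z i) (hz i)
    have h2 := hτ i' (z i) (hz i)
    rw [← hii, h1] at h2
    have h3 := mul_neg_of_pos_of_neg (hc i) (hzn i)
    have h4 := mul_nonneg (hc i').le (hzp i i' hne)
    linarith
  exact ⟨Equiv.ofBijective τ (Finite.injective_iff_bijective.1 hinj), c, hc, hτ⟩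


theorem aff_zero_span {V : Type*} [AddCommGroup V] [Module ℝ V] (Q : Set V) (φ : V →ᵃ[ℝ] ℝ)
    (h0 : ∀ y ∈ Q, φ y = 0) : ∀ y ∈ affineSpan ℝ Q, φ y = 0 := by
  intro y hy
  refine affineSpan_induction (p := fun y => φ y = 0) hy (fun x hx => h0 x hx) ?_
  intro c u v w hu hv hw
  rw [aff_move, hu, hv, hw]; ring

theorem minimal_system {V : Type*} [AddCommGroup V] [Module ℝ V] (f : ℕ) (Q : Set V)
    (hne : Q.Nonempty) (h : Fin f → V →ᵃ[ℝ] ℝ)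
    (hQ : ∀ y, y ∈ Q ↔ y ∈ affineSpan ℝ Q ∧ ∀ i, 0 ≤ h i y) :
    ∃ I : Finset (Fin f), (∀ y, y ∈ Q ↔ y ∈ affineSpan ℝ Q ∧ ∀ i ∈ I, 0 ≤ h i y) ∧
      (∃ q0 ∈ Q, ∀ i ∈ I, 0 < h i q0) ∧
      ∀ i ∈ I, ∃ z ∈ affineSpan ℝ Q, h i z < 0 ∧ ∀ j ∈ I, j ≠ i → 0 ≤ h j z := by
  classical
  obtain ⟨I, hI, hmin⟩ := Finset.exists_min_image
    (Finset.univ.filter fun I : Finset (Fin f) =>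
      ∀ y, y ∈ Q ↔ y ∈ affineSpan ℝ Q ∧ ∀ i ∈ I, 0 ≤ h i y) Finset.card
    ⟨Finset.univ, by simp only [Finset.mem_filter, Finset.mem_univ, true_and, forall_true_left]
                     exact hQ⟩
  simp only [Finset.mem_filter, Finset.mem_univ, true_and] at hI hmin
  have hz : ∀ i ∈ I, ∃ z ∈ affineSpan ℝ Q, h i z < 0 ∧ ∀ j ∈ I, j ≠ i → 0 ≤ h j z := by
    intro i hi
    by_contra hcon
    push Not at hcon
    have h1 := hmin (I.erase i) (by
      intro y
      rw [hI]
      refine and_congr_right fun hy => ⟨fun h1 j hj => h1 j (Finset.mem_of_mem_erase hj), ?_⟩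
      intro h1 j hj
      by_cases hji : j = i
      · subst hji
        by_contra hlt
        push Not at hlt
        obtain ⟨j', hj', hne', hlt'⟩ := hcon y hy hlt
        exact absurd (h1 j' (Finset.mem_erase.2 ⟨hne', hj'⟩)) (not_le.2 hlt')
      · exact h1 j (Finset.mem_erase.2 ⟨hji, hj⟩))
    have := Finset.card_erase_lt_of_mem hi
    omega
  refine ⟨I, hI, ?_, hz⟩
  have hposs : ∀ i ∈ I, ∃ y ∈ Q, 0 < h i y := by
    intro i hi
    by_contra hcon
    push Not at hcon
    obtain ⟨z, hzL, hzn, _⟩ := hz i hi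
    have := aff_zero_span Q (h i) (fun y hy => le_antisymm (hcon y hy) (((hI y).1 hy).2 i hi)) z hzL
    linarith
  have hind : ∀ S : Finset (Fin f), S ⊆ I → ∃ q ∈ Q, ∀ i ∈ S, 0 < h i q := by
    intro S
    induction S using Finset.induction_on with
    | empty => intro _; obtain ⟨q, hq⟩ := hne; exact ⟨q, hq, by simp⟩
    | insert a S ha ih =>
      intro hS
      obtain ⟨q, hq, hqS⟩ := ih (fun x hx => hS (Finset.mem_insert_of_mem hx))
      obtain ⟨y, hy, hya⟩ := hposs a (hS (Finset.mem_insert_self _ _))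
      have hq' := (hI q).1 hq
      have hy' := (hI y).1 hy
      refine ⟨AffineMap.lineMap q y (1/2:ℝ), (hI _).2 ⟨AffineMap.lineMap_mem _ hq'.1 hy'.1, ?_⟩, ?_⟩
      · intro i hi
        rw [aff_line]
        have h1 := hq'.2 i hi
        have h2 := hy'.2 i hi
        linarith
      · intro i hi
        rw [aff_line]
        have h1 := hq'.2 i (hS hi)
        have h2 := hy'.2 i (hS hi)
        rcases Finset.mem_insert.1 hi with rfl | hi
        · linarith
        · have := hqS i hi
          linarith
  exact hind I (Finset.Subset.refl _)

/-- values of a linear functional on the unit ball of a subspace -/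
def ballVals {d : ℕ} (D : Submodule ℝ (Fin d → ℝ)) (φ : (Fin d → ℝ) →ₗ[ℝ] ℝ) : Set ℝ :=
  {r | ∃ v ∈ D, v ⬝ᵥ v ≤ 1 ∧ φ v = r}

theorem ballVals_bdd {d : ℕ} (D : Submodule ℝ (Fin d → ℝ)) (φ : (Fin d → ℝ) →ₗ[ℝ] ℝ) :
    BddAbove (ballVals D φ) := by
  refine ⟨∑ i, |φ (fun j => if i = j then 1 else 0)|, ?_⟩
  rintro r ⟨v, _, hv, rfl⟩
  rw [LinearMap.pi_apply_eq_sum_univ φ v]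
  refine Finset.sum_le_sum fun i _ => ?_
  have h1 : v i * v i ≤ 1 := by
    refine le_trans ?_ hv
    unfold dotProduct
    exact Finset.single_le_sum (f := fun i => v i * v i) (fun i _ => mul_self_nonneg _)
      (Finset.mem_univ i)
  have h2 : |v i| ≤ 1 := by
    rw [abs_le]; constructor <;> nlinarith
  rw [smul_eq_mul]
  calc _ ≤ |v i * φ (fun j => if i = j then 1 else 0)| := le_abs_self _
    _ = |v i| * |φ (fun j => if i = j then 1 else 0)| := abs_mul _ _
    _ ≤ 1 * _ := by gcongr
    _ = _ := one_mul _

theorem ballVals_pos {d : ℕ} (D : Submodule ℝ (Fin d → ℝ)) (φ : (Fin d → ℝ) →ₗ[ℝ] ℝ)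
    (v : Fin d → ℝ) (hv : v ∈ D) (hφ : 0 < φ v) : 0 < sSup (ballVals D φ) := by
  have hvv : 0 ≤ v ⬝ᵥ v := by
    unfold dotProduct
    exact Finset.sum_nonneg fun i _ => mul_self_nonneg _
  have hN : 0 < 1 + v ⬝ᵥ v := by linarith
  refine lt_of_lt_of_le ?_ (le_csSup (ballVals_bdd D φ)
    ⟨(1 + v ⬝ᵥ v)⁻¹ • v, D.smul_mem _ hv, ?_, rfl⟩)
  · rw [map_smul, smul_eq_mul]; positivity
  · rw [smul_dotProduct, dotProduct_smul, smul_eq_mul, smul_eq_mul]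
    have h1 : (1 + v ⬝ᵥ v)⁻¹ * (v ⬝ᵥ v) ≤ 1 := by
      rw [inv_mul_le_iff₀ hN]; linarith
    have h2 : (1 + v ⬝ᵥ v)⁻¹ ≤ 1 := inv_le_one_of_one_le₀ (by linarith)
    have h3 : 0 ≤ (1 + v ⬝ᵥ v)⁻¹ := by positivity
    nlinarith [mul_nonneg h3 hvv]

/-- The affine map `y ↦ U y + u`. -/
def affU {d : ℕ} (U : Matrix (Fin d) (Fin d) ℝ) (u : Fin d → ℝ) :
    (Fin d → ℝ) →ᵃ[ℝ] (Fin d → ℝ) where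
  toFun y := U.mulVec y + u
  linear := U.mulVecLin
  map_vadd' p v := by
    simp [Matrix.mulVec_add, add_assoc]

open Pointwise in
theorem normalized_system {d f g : ℕ} (Aeq : Fin g → Fin d → ℝ) (beq : Fin g → ℝ)
    (A : Fin f → Fin d → ℝ) (b : Fin f → ℝ) (Q : Set (Fin d → ℝ))
    (hQdef : Q = {y : Fin d → ℝ | (∀ i : Fin g, ∑ j, Aeq i j * y j = beq i) ∧
              (∀ i : Fin f, ∑ j, A i j * y j ≤ b i)}) (hne : Q.Nonempty) :
    ∃ (I : Finset (Fin f)) (h : I → (Fin d → ℝ) →ᵃ[ℝ] ℝ),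
      (∀ y, y ∈ Q ↔ y ∈ affineSpan ℝ Q ∧ ∀ i, 0 ≤ h i y) ∧
      ∀ (U : Matrix (Fin d) (Fin d) ℝ) (u : Fin d → ℝ), U * U.transpose = 1 →
        (fun y : Fin d → ℝ => U.mulVec y + u) '' Q = Q →
        ∃ τ : Equiv.Perm I, ∀ i, ∀ y ∈ Q, h (τ i) (U.mulVec y + u) = h i y := by
  classical
  let mk : (Fin d → ℝ) → ℝ → ((Fin d → ℝ) →ᵃ[ℝ] ℝ) := fun a β =>
    AffineMap.const ℝ (Fin d → ℝ) β - (Fintype.linearCombination ℝ a).toAffineMap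
  have hmk : ∀ a β y, mk a β y = β - ∑ j, a j * y j := by
    intro a β y
    simp [mk, Fintype.linearCombination_apply, mul_comm]
  have hQ0 : ∀ y, y ∈ Q ↔ y ∈ affineSpan ℝ Q ∧ ∀ i, 0 ≤ mk (A i) (b i) y := by
    intro y
    constructor
    · intro hy
      refine ⟨subset_affineSpan ℝ Q hy, fun i => ?_⟩
      rw [hQdef] at hy
      rw [hmk]; linarith [hy.2 i]
    · rintro ⟨hy, h1⟩
      have h2 : ∀ i, mk (Aeq i) (beq i) y = 0 := fun i =>
        aff_zero_span Q _ (fun y hy => by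
          rw [hQdef] at hy
          rw [hmk]; linarith [hy.1 i]) y hy
      rw [hQdef]
      refine ⟨fun i => ?_, fun i => ?_⟩
      · have := h2 i; rw [hmk] at this; linarith
      · have := h1 i; rw [hmk] at this; linarith
  obtain ⟨I, hI, ⟨q0, hq0Q, hq0⟩, hz⟩ := minimal_system f Q hne _ hQ0
  choose! z hzL hzn hzp using hz
  set L := affineSpan ℝ Q with hLdef
  let h0 : I → (Fin d → ℝ) →ᵃ[ℝ] ℝ := fun i => mk (A i) (b i)
  let w : I → ℝ := fun i => sSup (ballVals L.direction (h0 i).linear)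
  have hq0L : q0 ∈ L := subset_affineSpan ℝ Q hq0Q
  have hw : ∀ i, 0 < w i := by
    intro i
    refine ballVals_pos _ _ (q0 -ᵥ z i) (AffineSubspace.vsub_mem_direction hq0L (hzL i i.2)) ?_
    rw [AffineMap.linearMap_vsub]
    have h1 := hq0 i i.2
    have h2 := hzn i i.2
    show 0 < mk (A i) (b i) q0 - mk (A i) (b i) (z i)
    linarith
  refine ⟨I, fun i => (w i)⁻¹ • h0 i, ?_, ?_⟩
  · intro y
    rw [hI]
    refine and_congr_right fun _ => ⟨fun h1 i => ?_, fun h1 i hi => ?_⟩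
    · exact mul_nonneg (inv_nonneg.2 (hw i).le) (h1 i i.2)
    · have h2 := h1 ⟨i, hi⟩
      exact nonneg_of_mul_nonneg_right (b := mk (A i) (b i) y) h2 (inv_pos.2 (hw ⟨i, hi⟩))
  · intro U u hU him
    have hU' : U.transpose * U = 1 := mul_eq_one_comm.1 hU
    have hinj : ∀ y y', affU U u y = affU U u y' → y = y' := by
      intro y y' hyy
      have h1 : U.mulVec y = U.mulVec y' := add_right_cancel hyy
      have h2 := congrArg (U.transpose.mulVec) h1
      simpa [Matrix.mulVec_mulVec, hU'] using h2
    have him' : affU U u '' Q = Q := him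
    have hmap : L.map (affU U u) = L := by
      rw [hLdef, AffineSubspace.map_span, him']
    have hL1 : ∀ y ∈ L, affU U u y ∈ L := by
      intro y hy
      rw [← hmap]; exact AffineSubspace.mem_map.2 ⟨y, hy, rfl⟩
    have hL2 : ∀ y ∈ L, ∃ x ∈ L, affU U u x = y := by
      intro y hy
      rw [← hmap] at hy; exact AffineSubspace.mem_map.1 hy
    obtain ⟨τ, c, hc, hτ⟩ := facet_perm L h0 q0 hq0L (fun j => hq0 j j.2) (fun j => z j)
      (fun j => hzL j j.2) (fun j => hzn j j.2)
      (fun i j hij => hzp i i.2 j j.2 (fun hh => hij (Subtype.ext hh.symm))) (affU U u) hL1 hL2 (by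
        intro y hy
        have e1 : (∀ j, 0 ≤ h0 j (affU U u y)) ↔ affU U u y ∈ Q := by
          rw [hI]
          exact ⟨fun hh => ⟨hL1 y hy, fun i hi => hh ⟨i, hi⟩⟩, fun hh j => hh.2 j j.2⟩
        have e2 : (∀ j, 0 ≤ h0 j y) ↔ y ∈ Q := by
          rw [hI]
          exact ⟨fun hh => ⟨hy, fun i hi => hh ⟨i, hi⟩⟩, fun hh j => hh.2 j j.2⟩
        rw [e1, e2]
        constructor
        · intro hh
          rw [← him'] at hh
          obtain ⟨y', hy', he⟩ := hh
          rwa [← hinj _ _ he]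
        · intro hh
          rw [← him']; exact ⟨y, hh, rfl⟩)
    have hlin : ∀ i, ∀ v ∈ L.direction, (h0 (τ i)).linear (U.mulVec v) = c i * (h0 i).linear v := by
      intro i v hv
      have h1 := hτ i (v +ᵥ q0) (AffineSubspace.vadd_mem_of_mem_direction hv hq0L)
      have h2 := hτ i q0 hq0L
      have h3 : affU U u (v +ᵥ q0) = U.mulVec v +ᵥ affU U u q0 := (affU U u).map_vadd q0 v
      rw [h3, AffineMap.map_vadd, AffineMap.map_vadd, h2] at h1
      simp only [vadd_eq_add] at h1
      linarith
    have hdot : ∀ v : Fin d → ℝ, U.mulVec v ⬝ᵥ U.mulVec v = v ⬝ᵥ v := by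
      intro v
      rw [Matrix.dotProduct_mulVec, ← Matrix.mulVec_transpose, Matrix.mulVec_mulVec, hU',
        Matrix.one_mulVec]
    have hdir : ∀ v ∈ L.direction, U.mulVec v ∈ L.direction := by
      intro v hv
      have h1 := hL1 _ (AffineSubspace.vadd_mem_of_mem_direction hv hq0L)
      have h3 : affU U u (v +ᵥ q0) = U.mulVec v +ᵥ affU U u q0 := (affU U u).map_vadd q0 v
      rw [h3] at h1
      exact (AffineSubspace.vadd_mem_iff_mem_direction _ (hL1 q0 hq0L)).1 h1
    have hdir2 : ∀ v ∈ L.direction, ∃ v' ∈ L.direction, U.mulVec v' = v := by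
      intro v hv
      obtain ⟨x, hx, hxe⟩ := hL2 _ (AffineSubspace.vadd_mem_of_mem_direction hv (hL1 q0 hq0L))
      refine ⟨x -ᵥ q0, AffineSubspace.vsub_mem_direction hx hq0L, ?_⟩
      have h3 : U.mulVec (x -ᵥ q0) = affU U u x -ᵥ affU U u q0 :=
        (affU U u).linearMap_vsub x q0
      rw [h3, hxe]; simp
    have hwτ : ∀ i, w (τ i) = c i * w i := by
      intro i
      have hs : ballVals L.direction (h0 (τ i)).linear
          = c i • ballVals L.direction (h0 i).linear := by
        ext r
        rw [Set.mem_smul_set]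
        constructor
        · rintro ⟨v, hv, hv1, rfl⟩
          obtain ⟨v', hv', rfl⟩ := hdir2 v hv
          exact ⟨_, ⟨v', hv', by rwa [hdot] at hv1, rfl⟩, (hlin i v' hv').symm⟩
        · rintro ⟨_, ⟨v, hv, hv1, rfl⟩, rfl⟩
          exact ⟨U.mulVec v, hdir v hv, by rwa [hdot], hlin i v hv⟩
      show sSup _ = _
      rw [hs, Real.sSup_smul_of_nonneg (hc i).le]; rfl
    refine ⟨τ, fun i y hy => ?_⟩
    have h1 := hτ i y (subset_affineSpan ℝ Q hy)
    show (w (τ i))⁻¹ * h0 (τ i) (affU U u y) = (w i)⁻¹ * h0 i y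
    rw [h1, hwτ]
    have := (hc i).ne'
    have := (hw i).ne'
    field_simp


theorem aff_comb {V E X : Type*} [AddCommGroup V] [Module ℝ V] [AddCommGroup E] [Module ℝ E]
    [Fintype X] (f : V →ᵃ[ℝ] E) (w : X → ℝ) (y : X → V) (hw : ∑ x, w x = 1) :
    f (∑ x, w x • y x) = ∑ x, w x • f (y x) := by
  have h1 : ∀ v, f v = f.linear v + f 0 := fun v => by
    have := congrFun f.decomp v
    simpa using this
  have h2 : ∀ x, w x • f (y x) = w x • f.linear (y x) + w x • f 0 := fun x => by
    rw [h1 (y x), smul_add]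
  rw [h1, map_sum, Finset.sum_congr rfl (fun x _ => h2 x),
    Finset.sum_add_distrib, ← Finset.sum_smul, hw, one_smul]
  simp only [map_smul]

theorem section_lemma {V E G I : Type*} [AddCommGroup V] [Module ℝ V] [AddCommGroup E] [Module ℝ E]
    [Group G] [Fintype G] [Fintype I] (act : G → E → E)
    (hmul : ∀ π σ x, act (π * σ) x = act π (act σ x))
    (hinj : ∀ π, Function.Injective (act π)) (Q : Set V) (p : V →ᵃ[ℝ] E) (h : I → V →ᵃ[ℝ] ℝ)
    (hQ : ∀ y, y ∈ Q ↔ y ∈ affineSpan ℝ Q ∧ ∀ i, 0 ≤ h i y)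
    (hsym : ∀ π, ∃ κ : V → V, κ '' Q = Q ∧ (∀ y ∈ Q, p (κ y) = act π (p y)) ∧
      ∃ τ : Equiv.Perm I, ∀ i, ∀ y ∈ Q, h (τ i) (κ y) = h i y) :
    ∃ s : E → I → ℝ, (∀ x ∈ p '' Q, ∀ j, 0 ≤ s x j) ∧
      (∀ π, ∃ τ : Equiv.Perm I, ∀ x ∈ p '' Q, ∀ j, s (act π x) (τ j) = s x j) ∧
      ∀ (X : Type) [Fintype X] (a : X → ℝ) (v : X → E), (∀ x, v x ∈ p '' Q) → ∑ x, a x = 1 →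
        (∀ j, 0 ≤ ∑ x, a x * s (v x) j) → ∑ x, a x • v x ∈ p '' Q := by
  classical
  let R : G × Equiv.Perm I → Prop := fun γ => ∃ κ : V → V, κ '' Q = Q ∧
    (∀ y ∈ Q, p (κ y) = act γ.1 (p y)) ∧ ∀ i, ∀ y ∈ Q, h (γ.2 i) (κ y) = h i y
  have hR : ∀ γ γ', R γ → R γ' → R (γ * γ') := by
    rintro ⟨π, τ⟩ ⟨π', τ'⟩ ⟨κ, h1, h2, h3⟩ ⟨κ', h1', h2', h3'⟩
    have hm : ∀ y ∈ Q, κ' y ∈ Q := fun y hy => by rw [← h1']; exact ⟨y, hy, rfl⟩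
    refine ⟨κ ∘ κ', by rw [Set.image_comp, h1', h1], fun y hy => ?_, fun i y hy => ?_⟩
    · show p (κ (κ' y)) = act (π * π') (p y)
      rw [h2 _ (hm y hy), h2' y hy, hmul]
    · show h (τ (τ' i)) (κ (κ' y)) = h i y
      rw [h3 _ _ (hm y hy), h3' i y hy]
  let Γ : Finset (G × Equiv.Perm I) := Finset.univ.filter R
  have hΓ : ∀ γ, γ ∈ Γ ↔ R γ := fun γ => by simp [Γ]
  have hRex : ∀ π, ∃ τ, R (π, τ) := by
    intro π
    obtain ⟨κ, h1, h2, τ, h3⟩ := hsym π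
    exact ⟨τ, κ, h1, h2, h3⟩
  have hP : ∀ π, ∀ x ∈ p '' Q, act π x ∈ p '' Q := by
    rintro π _ ⟨y, hy, rfl⟩
    obtain ⟨κ, h1, h2, _⟩ := hsym π
    exact ⟨κ y, by rw [← h1]; exact ⟨y, hy, rfl⟩, h2 y hy⟩
  have hy0 : ∀ x, ∃ y, x ∈ p '' Q → y ∈ Q ∧ p y = x := by
    intro x
    by_cases hx : x ∈ p '' Q
    · obtain ⟨y, hy, he⟩ := hx
      exact ⟨y, fun _ => ⟨hy, he⟩⟩
    · exact ⟨0, fun hh => absurd hh hx⟩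
  choose y0 hy0 using hy0
  refine ⟨fun x j => ∑ γ ∈ Γ, h (γ.2 j) (y0 (act γ.1 x)), ?_, ?_, ?_⟩
  · intro x hx j
    exact Finset.sum_nonneg fun γ _ => ((hQ _).1 (hy0 _ (hP γ.1 x hx)).1).2 _
  · intro π
    obtain ⟨τ, hτ⟩ := hRex π
    refine ⟨τ, fun x _ j => ?_⟩
    have him : Γ.image (fun γ => γ * (π, τ)) = Γ := by
      apply Finset.eq_of_subset_of_card_le
      · intro γ hγ
        obtain ⟨γ', hγ', rfl⟩ := Finset.mem_image.1 hγ
        exact (hΓ _).2 (hR _ _ ((hΓ _).1 hγ') hτ)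
      · rw [Finset.card_image_of_injective _ (mul_left_injective _)]
    show _ = ∑ γ ∈ Γ, h (γ.2 j) (y0 (act γ.1 x))
    conv_rhs => rw [← him]
    rw [Finset.sum_image (fun a _ b _ hab => mul_left_injective _ hab)]
    refine Finset.sum_congr rfl fun γ _ => ?_
    show h (γ.2 (τ j)) (y0 (act γ.1 (act π x))) = h (γ.2 (τ j)) (y0 (act (γ.1 * π) x))
    rw [hmul]
  · intro X _ a v hv ha hs
    have hY : ∀ (x : X) (γ : Γ), ∃ y ∈ Q, p y = v x ∧
        ∀ j, h (γ.1.2 j) (y0 (act γ.1.1 (v x))) = h j y := by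
      intro x γ
      obtain ⟨κ, h1, h2, h3⟩ := (hΓ _).1 γ.2
      obtain ⟨hm, hpe⟩ := hy0 _ (hP γ.1.1 _ (hv x))
      rw [← h1] at hm
      obtain ⟨y, hy, he⟩ := hm
      refine ⟨y, hy, ?_, fun j => ?_⟩
      · apply hinj γ.1.1
        rw [← h2 y hy, he, hpe]
      · rw [← he, h3 j y hy]
    choose Y hYQ hYp hYh using hY
    have hne : (0:ℝ) < Fintype.card Γ := by
      obtain ⟨τ, hτ⟩ := hRex 1
      have : 0 < Fintype.card Γ := Fintype.card_pos_iff.2 ⟨⟨_, (hΓ _).2 hτ⟩⟩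
      exact_mod_cast this
    let W : X × Γ → ℝ := fun q => a q.1 / Fintype.card Γ
    have hW : ∑ q, W q = 1 := by
      rw [Fintype.sum_prod_type]
      simp only [W, Finset.sum_const, Finset.card_univ, nsmul_eq_mul]
      rw [← ha]
      refine Finset.sum_congr rfl fun x _ => ?_
      field_simp
    refine ⟨∑ q, W q • Y q.1 q.2, ?_, ?_⟩
    · rw [hQ]
      constructor
      · rw [← Finset.affineCombination_eq_linear_combination Finset.univ
          (fun q : X × Γ => Y q.1 q.2) W hW]
        refine affineSpan_mono ℝ ?_ (affineCombination_mem_affineSpan hW (fun q : X × Γ => Y q.1 q.2))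
        rintro _ ⟨q, rfl⟩
        exact hYQ _ _
      · intro j
        rw [aff_comb (h j) W _ hW, Fintype.sum_prod_type]
        have h1 : ∀ x : X, ∑ γ : Γ, W (x, γ) • h j (Y x γ)
            = (Fintype.card Γ : ℝ)⁻¹ * (a x * ∑ γ ∈ Γ, h (γ.2 j) (y0 (act γ.1 (v x)))) := by
          intro x
          rw [← Finset.sum_coe_sort Γ, Finset.mul_sum, Finset.mul_sum]
          refine Finset.sum_congr rfl fun γ _ => ?_
          rw [hYh x γ j, smul_eq_mul]
          simp only [W]
          field_simp
        rw [Finset.sum_congr rfl fun x _ => h1 x, ← Finset.mul_sum]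
        exact mul_nonneg (inv_nonneg.2 hne.le) (hs j)
    · rw [aff_comb p W _ hW, Fintype.sum_prod_type]
      refine Finset.sum_congr rfl fun x _ => ?_
      simp only [hYp, W]
      rw [Finset.sum_const, Finset.card_univ, ← Nat.cast_smul_eq_nsmul ℝ, smul_smul]
      congr 1
      field_simp


theorem edgeMap_mul {n : ℕ} (π σ : Equiv.Perm (Fin n)) (e : Edge n) :
    edgeMap (π * σ) e = edgeMap π (edgeMap σ e) := by
  apply Subtype.ext
  simp [edgeMap, Sym2.map_map]

theorem edgeMap_one {n : ℕ} (e : Edge n) : edgeMap 1 e = e := by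
  apply Subtype.ext
  simp [edgeMap]

theorem edgeMap_inv_self {n : ℕ} (π : Equiv.Perm (Fin n)) (e : Edge n) :
    edgeMap π⁻¹ (edgeMap π e) = e := by
  rw [← edgeMap_mul, inv_mul_cancel, edgeMap_one]

theorem edgeMap_self_inv {n : ℕ} (π : Equiv.Perm (Fin n)) (e : Edge n) :
    edgeMap π (edgeMap π⁻¹ e) = e := by
  rw [← edgeMap_mul, mul_inv_cancel, edgeMap_one]

theorem edgeMap_inj {n : ℕ} (π : Equiv.Perm (Fin n)) : Function.Injective (edgeMap π) :=
  Function.LeftInverse.injective (edgeMap_inv_self π)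

theorem mem_edgeMap {n : ℕ} (π : Equiv.Perm (Fin n)) (e : Edge n) (v : Fin n) :
    v ∈ (edgeMap π e).1 ↔ π⁻¹ v ∈ e.1 := by
  simp only [edgeMap, Sym2.mem_map]
  constructor
  · rintro ⟨a, ha, rfl⟩; simpa using ha
  · intro h; exact ⟨_, h, by simp⟩

theorem edgeAction_mul {n : ℕ} (π σ : Equiv.Perm (Fin n)) (x : Edge n → ℝ) :
    edgeAction (π * σ) x = edgeAction π (edgeAction σ x) := by
  funext e
  simp only [edgeAction, mul_inv_rev, edgeMap_mul]

theorem edgeAction_inj {n : ℕ} (π : Equiv.Perm (Fin n)) :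
    Function.Injective (edgeAction π) := by
  intro x y h
  funext e
  have := congrFun h (edgeMap π e)
  simpa only [edgeAction, edgeMap_inv_self] using this

/-- image of an edge set under a node permutation -/
def mv {n : ℕ} (π : Equiv.Perm (Fin n)) (M : Finset (Edge n)) : Finset (Edge n) :=
  M.image (edgeMap π)

theorem mem_mv {n : ℕ} (π : Equiv.Perm (Fin n)) (M : Finset (Edge n)) (e : Edge n) :
    e ∈ mv π M ↔ edgeMap π⁻¹ e ∈ M := by
  simp only [mv, Finset.mem_image]
  constructor
  · rintro ⟨a, ha, rfl⟩; rwa [edgeMap_inv_self]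
  · intro h; exact ⟨_, h, edgeMap_self_inv _ _⟩

theorem edgeAction_charVec {n : ℕ} (π : Equiv.Perm (Fin n)) (M : Finset (Edge n)) :
    edgeAction π (charVec M) = charVec (mv π M) := by
  funext e
  simp only [edgeAction, charVec, mem_mv]

theorem mv_card {n : ℕ} (π : Equiv.Perm (Fin n)) (M : Finset (Edge n)) :
    (mv π M).card = M.card := Finset.card_image_of_injective _ (edgeMap_inj π)

theorem mv_subset {n : ℕ} (π : Equiv.Perm (Fin n)) {M N : Finset (Edge n)} :
    mv π M ⊆ mv π N ↔ M ⊆ N := Finset.image_subset_image_iff (edgeMap_inj π)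

theorem mv_inj {n : ℕ} (π : Equiv.Perm (Fin n)) : Function.Injective (mv π) :=
  Finset.image_injective (edgeMap_inj π)

theorem IsMatching.mv {n : ℕ} {M : Finset (Edge n)} (h : IsMatching M) (π : Equiv.Perm (Fin n)) :
    IsMatching (mv π M) := by
  intro e he f hf hne v hv
  rw [mem_mv] at he hf
  refine h _ he _ hf (fun hh => hne (edgeMap_inj _ hh)) (π⁻¹ v) ⟨?_, ?_⟩
  · rw [mem_edgeMap]; simpa using hv.1
  · rw [mem_edgeMap]; simpa using hv.2

theorem IsMatching.subset {n : ℕ} {M N : Finset (Edge n)} (h : IsMatching M) (hN : N ⊆ M) :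
    IsMatching N := fun e he f hf => h e (hN he) f (hN hf)

/-- type of an edge w.r.t. a coloring of the nodes -/
def ety {n : ℕ} {C : Type} (color : Fin n → C) (e : Edge n) : Sym2 C := Sym2.map color e.1

theorem ety_edgeMap {n : ℕ} {C : Type} (color : Fin n → C) (π : Equiv.Perm (Fin n))
    (h : ∀ v, color (π v) = color v) (e : Edge n) : ety color (edgeMap π e) = ety color e := by
  simp only [ety, edgeMap, Sym2.map_map]
  congr 1
  funext v
  exact h v

theorem match_perm {n : ℕ} {C : Type} [DecidableEq C] (color : Fin n → C) (D D' : Finset (Edge n))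
    (hD : IsMatching D) (hD' : IsMatching D')
    (hcount : ∀ θ, (D.filter fun e => ety color e = θ).card = (D'.filter fun e => ety color e = θ).card)
    (Z : Equiv.Perm (Fin n) → Prop) (Z1 : Z 1)
    (Zs : ∀ ρ x y, x ≠ y → color x = color y → Z ρ → Z (Equiv.swap x y * ρ))
    (Zc : ∀ ρ, Z ρ → ∀ v, color (ρ v) = color v) : ∃ ρ, Z ρ ∧ mv ρ D = D' := by
  have heq : ∀ θ, Nonempty ({e : D // ety color e.1 = θ} ≃ {e : D' // ety color e.1 = θ}) := by
    intro θ
    rw [← Fintype.card_eq]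
    have key : ∀ D : Finset (Edge n), Fintype.card {e : D // ety color e.1 = θ}
        = (D.filter fun e => ety color e = θ).card := by
      intro D
      rw [Fintype.card_subtype, ← Finset.card_map (Function.Embedding.subtype (fun e => e ∈ D))]
      congr 1
      ext e
      simp
      exact and_comm
    rw [key, key, hcount]
  let Φ : D ≃ D' := Equiv.ofFiberEquiv (f := fun e : D => ety color e.1)
    (g := fun e : D' => ety color e.1) (fun θ => (heq θ).some)
  have hΦ : ∀ e : D, ety color (Φ e).1 = ety color e.1 := fun e =>
    Equiv.ofFiberEquiv_map (f := fun e : D => ety color e.1)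
      (g := fun e : D' => ety color e.1) (fun θ => (heq θ).some) e
  have hends : ∀ e : D, ∃ x y x' y' : Fin n, e.1.1 = s(x, y) ∧ (Φ e).1.1 = s(x', y') ∧
      color x = color x' ∧ color y = color y' := by
    intro e
    have h1 := hΦ e
    unfold ety at h1
    obtain ⟨x, y, hxy⟩ : ∃ x y, e.1.1 = s(x, y) := by
      induction e.1.1 using Sym2.ind with
      | _ x y => exact ⟨x, y, rfl⟩
    obtain ⟨x', y', hxy'⟩ : ∃ x y, (Φ e).1.1 = s(x, y) := by
      induction (Φ e).1.1 using Sym2.ind with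
      | _ x y => exact ⟨x, y, rfl⟩
    rw [hxy, hxy', Sym2.map_mk, Sym2.map_mk, Sym2.eq_iff] at h1
    rcases h1 with ⟨h1, h2⟩ | ⟨h1, h2⟩
    · exact ⟨x, y, x', y', hxy, hxy', h1.symm, h2.symm⟩
    · exact ⟨x, y, y', x', hxy, by rw [hxy', Sym2.eq_swap], h2.symm, h1.symm⟩
  choose x y x' y' hxy hxy' hcx hcy using hends
  have hdiag : ∀ (e : Edge n) (a b : Fin n), e.1 = s(a, b) → a ≠ b := by
    intro e a b h hab
    apply e.2
    rw [h, hab]; simp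
  have hinj : ∀ (D0 : Finset (Edge n)) (Φ : D → D0) (_ : Function.Injective Φ) (x y : D → Fin n),
      IsMatching D0 → (∀ e, (Φ e).1.1 = s(x e, y e)) →
      Function.Injective (fun q : D × Bool => if q.2 then x q.1 else y q.1) := by
    rintro D0 Φ hΦ x y hm hxy ⟨e, b⟩ ⟨e', b'⟩ h
    have hmem : ∀ (e : D) (b : Bool), (if b then x e else y e) ∈ (Φ e).1.1 := by
      intro e b
      rw [hxy]
      cases b <;> simp
    simp only at h
    have hee : e = e' := by
      by_contra hne
      refine hm _ (Φ e).2 _ (Φ e').2 (fun hh => hne (hΦ (Subtype.ext hh))) _ ⟨hmem e b, ?_⟩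
      rw [h]; exact hmem e' b'
    subst hee
    have hd := hdiag _ _ _ (hxy e)
    cases b <;> cases b'
    · rfl
    · exact absurd (by simpa using h.symm) hd
    · exact absurd (by simpa using h) hd
    · rfl
  obtain ⟨ρ, hρ, hρf⟩ := ext_swaps color (fun q : D × Bool => if q.2 then x q.1 else y q.1)
    (fun q : D × Bool => if q.2 then x' q.1 else y' q.1)
    (hinj D id Function.injective_id x y hD hxy) (hinj D' Φ Φ.injective x' y' hD' hxy')
    (by rintro ⟨e, b⟩; cases b <;> simp [hcx, hcy]) Z Z1 Zs Zc
  refine ⟨ρ, hρ, ?_⟩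
  have hmap : ∀ e : D, edgeMap ρ e.1 = (Φ e).1 := by
    intro e
    apply Subtype.ext
    simp only [edgeMap]
    rw [hxy, hxy', Sym2.map_mk]
    have h1 := hρf (e, true)
    have h2 := hρf (e, false)
    simp at h1 h2
    rw [h1, h2]
  ext e
  simp only [mv, Finset.mem_image]
  constructor
  · rintro ⟨a, ha, rfl⟩
    rw [hmap ⟨a, ha⟩]; exact (Φ _).2
  · intro he
    refine ⟨(Φ.symm ⟨e, he⟩).1, (Φ.symm ⟨e, he⟩).2, ?_⟩
    rw [hmap]; simp


/-- edge touches the node set `U` -/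
def touch {n : ℕ} (U : Finset (Fin n)) (e : Edge n) : Prop := ∃ u ∈ U, u ∈ e.1

open Classical in
/-- the touched part of an edge set -/
noncomputable def tpart {n : ℕ} (U : Finset (Fin n)) (M : Finset (Edge n)) : Finset (Edge n) :=
  M.filter (touch U)

theorem touch_card {n : ℕ} (U : Finset (Fin n)) (F : Finset (Edge n)) (hF : IsMatching F)
    (ht : ∀ e ∈ F, touch U e) : F.card ≤ U.card := by
  unfold touch at ht
  have ht' : ∀ e : Edge n, ∃ u, e ∈ F → u ∈ U ∧ u ∈ e.1 := by
    intro e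
    by_cases he : e ∈ F
    · obtain ⟨u, hu⟩ := ht e he
      exact ⟨u, fun _ => hu⟩
    · induction e.1 using Sym2.ind with
      | _ x y => exact ⟨x, fun h => absurd h he⟩
  choose u hu' using ht'
  have hu := fun e he => (hu' e he).1
  have hue := fun e he => (hu' e he).2
  refine Finset.card_le_card_of_injOn u hu ?_
  intro e he f hf hef
  by_contra hne
  refine hF e he f hf hne (u e) ⟨hue e he, ?_⟩
  rw [hef]; exact hue f hf

theorem two_swaps {n : ℕ} (H : Subgroup (Equiv.Perm (Fin n))) (U : Finset (Fin n))
    (hC : ∀ a b c, a ∉ U → b ∉ U → c ∉ U → a ≠ b → b ≠ c → a ≠ c → Cyc H a b c)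
    (x y x' y' : Fin n) (hx : x ∉ U) (hy : y ∉ U) (hx' : x' ∉ U) (hy' : y' ∉ U)
    (hxy : x ≠ y) (hxy' : x' ≠ y') : Equiv.swap x y * Equiv.swap x' y' ∈ H := by
  have h3 : ∀ a b c, a ∉ U → b ∉ U → c ∉ U → a ≠ b → b ≠ c →
      Equiv.swap a b * Equiv.swap b c ∈ H := by
    intro a b c ha hb hc hab hbc
    by_cases hac : a = c
    · subst hac
      rw [Equiv.swap_comm b a, Equiv.swap_mul_self]; exact H.one_mem
    · exact (hC a b c ha hb hc hab hbc hac).2.2.2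
  by_cases h : y = x'
  · subst h; exact h3 _ _ _ hx hy hy' hxy hxy'
  · have h1 := h3 x y x' hx hy hx' hxy h
    have h2 := h3 y x' y' hy hx' hy' h hxy'
    have := H.mul_mem h1 h2
    rwa [mul_assoc, ← mul_assoc (Equiv.swap y x'), Equiv.swap_mul_self, one_mul] at this

theorem edgeMap_fix {n : ℕ} (π : Equiv.Perm (Fin n)) (e : Edge n) (h : ∀ v ∈ e.1, π v = v) :
    edgeMap π e = e := by
  apply Subtype.ext
  simp only [edgeMap]
  rw [Sym2.map_congr (g := id) h, Sym2.map_id]; rfl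

theorem mv_fix {n : ℕ} (π : Equiv.Perm (Fin n)) (M : Finset (Edge n))
    (h : ∀ e ∈ M, ∀ v ∈ e.1, π v = v) : mv π M = M := by
  unfold mv
  rw [Finset.image_congr (g := id) (fun e he => edgeMap_fix π e (h e he)), Finset.image_id]

theorem mv_mul {n : ℕ} (π σ : Equiv.Perm (Fin n)) (M : Finset (Edge n)) :
    mv (π * σ) M = mv π (mv σ M) := by
  unfold mv
  rw [Finset.image_image]
  exact Finset.image_congr fun e _ => edgeMap_mul π σ e

open Classical in
theorem dep {n : ℕ} (H : Subgroup (Equiv.Perm (Fin n))) (U : Finset (Fin n))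
    (hC : ∀ a b c, a ∉ U → b ∉ U → c ∉ U → a ≠ b → b ≠ c → a ≠ c → Cyc H a b c)
    (M M' : Finset (Edge n)) (hM : IsMatching M) (hM' : IsMatching M')
    (hcard : M.card = M'.card) (hU : U.card < M'.card) (hF : tpart U M = tpart U M') :
    ∃ ρ ∈ H, mv ρ M = M' := by
  set F := tpart U M with hFdef
  have hFM : F ⊆ M := Finset.filter_subset _ _
  have hFM' : F ⊆ M' := by rw [hF]; exact Finset.filter_subset _ _
  have hFt : ∀ e ∈ F, touch U e := fun e he => (Finset.mem_filter.1 he).2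
  have hunt : ∀ e ∈ M, e ∉ F → ¬ touch U e := fun e he hn ht =>
    hn (Finset.mem_filter.2 ⟨he, ht⟩)
  have hunt' : ∀ e ∈ M', e ∉ F → ¬ touch U e := fun e he hn ht =>
    hn (by rw [hF]; exact Finset.mem_filter.2 ⟨he, ht⟩)
  have hFc := touch_card U F (hM.subset hFM) hFt
  obtain ⟨e0, he0, he0F⟩ := Finset.exists_mem_notMem_of_card_lt_card (lt_of_le_of_lt hFc hU)
  obtain ⟨a0, b0, hab0⟩ : ∃ x y, e0.1 = s(x, y) := by
    induction e0.1 using Sym2.ind with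
    | _ x y => exact ⟨x, y, rfl⟩
  have hab : a0 ≠ b0 := by
    intro hab
    apply e0.2
    rw [hab0, hab]; simp
  have ha0 : a0 ∉ U := fun h => hunt' e0 he0 he0F ⟨a0, h, by rw [hab0]; simp⟩
  have hb0 : b0 ∉ U := fun h => hunt' e0 he0 he0F ⟨b0, h, by rw [hab0]; simp⟩
  let color : Fin n → Option (Fin n) := fun v =>
    if v ∈ U ∨ ∃ e ∈ F, v ∈ e.1 then some v else none
  have hcol1 : ∀ v, (v ∈ U ∨ ∃ e ∈ F, v ∈ e.1) → color v = some v := fun v h => if_pos h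
  have hcol2 : ∀ v, ¬ (v ∈ U ∨ ∃ e ∈ F, v ∈ e.1) → color v = none := fun v h => if_neg h
  have hcolU : ∀ x y, x ≠ y → color x = color y → x ∉ U := by
    intro x y hxy hc hx
    rw [hcol1 x (Or.inl hx)] at hc
    by_cases hy : y ∈ U ∨ ∃ e ∈ F, y ∈ e.1
    · rw [hcol1 y hy] at hc
      exact hxy (Option.some_injective _ hc)
    · rw [hcol2 y hy] at hc
      exact absurd hc (by simp)
  have htype : ∀ N : Finset (Edge n), IsMatching N → F ⊆ N → (∀ e ∈ N, e ∉ F → ¬ touch U e) →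
      ∀ e ∈ N \ F, ety color e = s(none, none) := by
    intro N hN hFN hNt e he
    rw [Finset.mem_sdiff] at he
    have hnone : ∀ v ∈ e.1, color v = none := by
      intro v hv
      apply hcol2
      rintro (h | ⟨e', he', hv'⟩)
      · exact hNt e he.1 he.2 ⟨v, h, hv⟩
      · refine hN e he.1 e' (hFN he') ?_ v ⟨hv, hv'⟩
        rintro rfl
        exact he.2 he'
    unfold ety
    revert hnone
    induction e.1 using Sym2.ind with
    | _ x y =>
      intro hnone
      rw [Sym2.map_mk, hnone x (by simp), hnone y (by simp)]
  have ht1 := htype M hM hFM hunt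
  have ht2 := htype M' hM' hFM' hunt'
  have hsd : (M \ F).card = (M' \ F).card := by
    rw [Finset.card_sdiff_of_subset hFM, Finset.card_sdiff_of_subset hFM', hcard]
  obtain ⟨ρ, ⟨hρ, hρc⟩, hρD⟩ := match_perm color (M \ F) (M' \ F) (hM.subset Finset.sdiff_subset)
    (hM'.subset Finset.sdiff_subset) (by
      intro θ
      by_cases hθ : θ = s(none, none)
      · rw [Finset.filter_true_of_mem (fun e he => by rw [ht1 e he, hθ]),
          Finset.filter_true_of_mem (fun e he => by rw [ht2 e he, hθ]), hsd]
      · rw [Finset.filter_false_of_mem (fun e he => by rw [ht1 e he]; exact fun h => hθ h.symm),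
          Finset.filter_false_of_mem (fun e he => by rw [ht2 e he]; exact fun h => hθ h.symm)])
    (fun ρ => (ρ ∈ H ∨ Equiv.swap a0 b0 * ρ ∈ H) ∧ ∀ v, color (ρ v) = color v)
    ⟨Or.inl H.one_mem, fun v => rfl⟩ (by
      rintro ρ x y hxy hc ⟨h1, h2⟩
      have hx := hcolU x y hxy hc
      have hy := hcolU y x hxy.symm hc.symm
      constructor
      · rcases h1 with h1 | h1
        · right
          rw [← mul_assoc]
          exact H.mul_mem (two_swaps H U hC _ _ _ _ ha0 hb0 hx hy hab hxy) h1
        · left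
          have := H.mul_mem (two_swaps H U hC _ _ _ _ hx hy ha0 hb0 hxy hab) h1
          rwa [mul_assoc, ← mul_assoc (Equiv.swap a0 b0), Equiv.swap_mul_self, one_mul] at this
      · intro v
        rw [← h2 v, Equiv.Perm.mul_apply]
        by_cases h3 : ρ v = x
        · rw [h3, Equiv.swap_apply_left, hc]
        · by_cases h4 : ρ v = y
          · rw [h4, Equiv.swap_apply_right, hc]
          · rw [Equiv.swap_apply_of_ne_of_ne h3 h4]) (fun ρ h => h.2)
  have hfixF : mv ρ F = F := by
    apply mv_fix
    intro e he v hv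
    have h1 := hρc v
    rw [hcol1 v (Or.inr ⟨e, he, hv⟩)] at h1
    by_cases hy : ρ v ∈ U ∨ ∃ e ∈ F, ρ v ∈ e.1
    · rw [hcol1 _ hy] at h1
      exact Option.some_injective _ h1
    · rw [hcol2 _ hy] at h1
      exact absurd h1 (by simp)
  have hmvM : mv ρ M = M' := by
    have h1 : M = F ∪ (M \ F) := by rw [Finset.union_sdiff_of_subset hFM]
    have h2 : M' = F ∪ (M' \ F) := by rw [Finset.union_sdiff_of_subset hFM']
    have h3 : mv ρ (F ∪ (M \ F)) = mv ρ F ∪ mv ρ (M \ F) := Finset.image_union _ _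
    rw [h2, ← hρD, h1, h3, hfixF, ← h1]
  rcases hρ with hρ | hρ
  · exact ⟨ρ, hρ, hmvM⟩
  · refine ⟨_, hρ, ?_⟩
    rw [mv_mul, hmvM]
    unfold mv
    rw [Finset.image_congr (g := id), Finset.image_id]
    intro e he
    by_cases hee : e = e0
    · rw [hee]
      apply Subtype.ext
      simp only [edgeMap, id]
      rw [hab0, Sym2.map_mk, Equiv.swap_apply_left, Equiv.swap_apply_right, Sym2.eq_swap]
    · apply edgeMap_fix
      intro v hv
      apply Equiv.swap_apply_of_ne_of_ne
      · rintro rfl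
        exact hM' e he e0 he0 hee _ ⟨hv, by rw [hab0]; simp⟩
      · rintro rfl
        exact hM' e he e0 he0 hee _ ⟨hv, by rw [hab0]; simp⟩


/-- part of an edge set of a given type -/
def prt {n : ℕ} (color : Fin n → Fin 3) (θ : Sym2 (Fin 3)) (M : Finset (Edge n)) :
    Finset (Edge n) := M.filter fun e => ety color e = θ

open Classical in
/-- matchings of type `(a,b,c)` -/
noncomputable def Tset {n : ℕ} (color : Fin n → Fin 3) (a b c : ℕ) : Finset (Finset (Edge n)) :=
  Finset.univ.filter fun M => IsMatching M ∧ M.card = a + b + c ∧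
    (prt color s(0, 0) M).card = a ∧ (prt color s(1, 1) M).card = b ∧
    (prt color s(0, 1) M).card = c

theorem mem_Tset {n : ℕ} {color : Fin n → Fin 3} {a b c : ℕ} {M : Finset (Edge n)} :
    M ∈ Tset color a b c ↔ IsMatching M ∧ M.card = a + b + c ∧
    (prt color s(0, 0) M).card = a ∧ (prt color s(1, 1) M).card = b ∧
    (prt color s(0, 1) M).card = c := by
  simp [Tset]

theorem prt_union_card {n : ℕ} (color : Fin n → Fin 3) (M : Finset (Edge n)) :
    (prt color s(0, 0) M ∪ prt color s(1, 1) M ∪ prt color s(0, 1) M).card =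
     (prt color s(0, 0) M).card + (prt color s(1, 1) M).card + (prt color s(0, 1) M).card := by
  have hd : ∀ θ θ', θ ≠ θ' → Disjoint (prt color θ M) (prt color θ' M) := by
    intro θ θ' hne
    rw [Finset.disjoint_left]
    intro e he he'
    exact hne ((Finset.mem_filter.1 he).2.symm.trans (Finset.mem_filter.1 he').2)
  rw [Finset.card_union_of_disjoint, Finset.card_union_of_disjoint]
  · exact hd _ _ (by decide)
  · rw [Finset.disjoint_union_left]
    exact ⟨hd _ _ (by decide), hd _ _ (by decide)⟩

theorem Tset_union {n : ℕ} {color : Fin n → Fin 3} {a b c : ℕ} {M : Finset (Edge n)}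
    (hM : M ∈ Tset color a b c) :
    prt color s(0, 0) M ∪ prt color s(1, 1) M ∪ prt color s(0, 1) M = M := by
  obtain ⟨_, h1, h2, h3, h4⟩ := mem_Tset.1 hM
  apply Finset.eq_of_subset_of_card_le
  · exact Finset.union_subset (Finset.union_subset (Finset.filter_subset _ _)
      (Finset.filter_subset _ _)) (Finset.filter_subset _ _)
  · rw [prt_union_card, h1, h2, h3, h4]

theorem Tset_types {n : ℕ} {color : Fin n → Fin 3} {a b c : ℕ} {M : Finset (Edge n)}
    (hM : M ∈ Tset color a b c) (e : Edge n) (he : e ∈ M) :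
    ety color e = s(0, 0) ∨ ety color e = s(1, 1) ∨ ety color e = s(0, 1) := by
  rw [← Tset_union hM] at he
  simp only [Finset.mem_union, prt, Finset.mem_filter] at he
  tauto

theorem prt_mv {n : ℕ} (color : Fin n → Fin 3) (θ : Sym2 (Fin 3)) (M : Finset (Edge n))
    (ρ : Equiv.Perm (Fin n)) (hρ : ∀ v, color (ρ v) = color v) :
    prt color θ (mv ρ M) = mv ρ (prt color θ M) := by
  unfold prt mv
  rw [Finset.filter_image]
  simp only [ety_edgeMap color ρ hρ]

theorem Tset_mv {n : ℕ} {color : Fin n → Fin 3} {a b c : ℕ} {M : Finset (Edge n)}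
    (hM : M ∈ Tset color a b c) (ρ : Equiv.Perm (Fin n)) (hρ : ∀ v, color (ρ v) = color v) :
    mv ρ M ∈ Tset color a b c := by
  rw [mem_Tset] at hM ⊢
  obtain ⟨h0, h1, h2, h3, h4⟩ := hM
  refine ⟨h0.mv ρ, ?_, ?_, ?_, ?_⟩
  · rw [mv_card, h1]
  · rw [prt_mv _ _ _ _ hρ, mv_card, h2]
  · rw [prt_mv _ _ _ _ hρ, mv_card, h3]
  · rw [prt_mv _ _ _ _ hρ, mv_card, h4]

theorem Tset_trans {n : ℕ} {color : Fin n → Fin 3} {a b c : ℕ} {F N : Finset (Edge n)}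
    (hF : F ∈ Tset color a b c) (hN : N ∈ Tset color a b c) :
    ∃ ρ : Equiv.Perm (Fin n), (∀ v, color (ρ v) = color v) ∧ mv ρ F = N := by
  have hF' := mem_Tset.1 hF
  have hN' := mem_Tset.1 hN
  refine match_perm color F N hF'.1 hN'.1 ?_ (fun ρ => ∀ v, color (ρ v) = color v) (fun v => rfl)
    ?_ (fun ρ h => h)
  · intro θ
    show (prt color θ F).card = (prt color θ N).card
    by_cases h1 : θ = s(0, 0)
    · rw [h1, hF'.2.2.1, hN'.2.2.1]
    by_cases h2 : θ = s(1, 1)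
    · rw [h2, hF'.2.2.2.1, hN'.2.2.2.1]
    by_cases h3 : θ = s(0, 1)
    · rw [h3, hF'.2.2.2.2, hN'.2.2.2.2]
    have h0 : ∀ M ∈ Tset color a b c, prt color θ M = ∅ := by
      intro M hM
      apply Finset.filter_false_of_mem
      intro e he hh
      have := Tset_types hM e he
      rw [hh] at this
      tauto
    rw [h0 F hF, h0 N hN]
  · intro ρ x y _ hc h2 v
    rw [← h2 v, Equiv.Perm.mul_apply]
    by_cases h3 : ρ v = x
    · rw [h3, Equiv.swap_apply_left, hc]
    · by_cases h4 : ρ v = y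
      · rw [h4, Equiv.swap_apply_right, hc]
      · rw [Equiv.swap_apply_of_ne_of_ne h3 h4]

theorem Tset_sub_card {n : ℕ} {color : Fin n → Fin 3} {a b c p q m : ℕ} {M : Finset (Edge n)}
    (hM : M ∈ Tset color p q m) :
    ((Tset color a b c).filter fun N => N ⊆ M).card = p.choose a * q.choose b * m.choose c := by
  obtain ⟨h0, h1, h2, h3, h4⟩ := mem_Tset.1 hM
  have hcard : ((Finset.powersetCard a (prt color s(0, 0) M)) ×ˢ
      (Finset.powersetCard b (prt color s(1, 1) M)) ×ˢ
      (Finset.powersetCard c (prt color s(0, 1) M))).card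
      = p.choose a * q.choose b * m.choose c := by
    rw [Finset.card_product, Finset.card_product, Finset.card_powersetCard,
      Finset.card_powersetCard, Finset.card_powersetCard, h2, h3, h4, mul_assoc]
  rw [← hcard]
  have hps : ∀ θ X Y Z, X ⊆ prt color s(0, 0) M → Y ⊆ prt color s(1, 1) M →
      Z ⊆ prt color s(0, 1) M → prt color θ (X ∪ Y ∪ Z) =
        if θ = s(0, 0) then X else if θ = s(1, 1) then Y else if θ = s(0, 1) then Z else ∅ := by
    intro θ X Y Z hX hY hZ
    have e1 : ∀ e ∈ X, ety color e = s(0, 0) := fun e he => (Finset.mem_filter.1 (hX he)).2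
    have e2 : ∀ e ∈ Y, ety color e = s(1, 1) := fun e he => (Finset.mem_filter.1 (hY he)).2
    have e3 : ∀ e ∈ Z, ety color e = s(0, 1) := fun e he => (Finset.mem_filter.1 (hZ he)).2
    have d1 : (s(0, 0) : Sym2 (Fin 3)) ≠ s(1, 1) := by decide
    have d2 : (s(0, 0) : Sym2 (Fin 3)) ≠ s(0, 1) := by decide
    have d3 : (s(1, 1) : Sym2 (Fin 3)) ≠ s(0, 1) := by decide
    ext e
    simp only [prt, Finset.mem_filter, Finset.mem_union]
    have e1 := e1 e
    have e2 := e2 e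
    have e3 := e3 e
    split_ifs with i1 i2 i3 <;> grind
  refine Finset.card_nbij' (fun N => (prt color s(0, 0) N, prt color s(1, 1) N, prt color s(0, 1) N))
    (fun X => X.1 ∪ X.2.1 ∪ X.2.2) ?_ ?_ ?_ ?_
  · intro N hN
    obtain ⟨hNT, hNM⟩ := Finset.mem_filter.1 hN
    obtain ⟨g0, g1, g2, g3, g4⟩ := mem_Tset.1 hNT
    simp only [Finset.mem_coe, Finset.mem_product, Finset.mem_powersetCard]
    exact ⟨⟨Finset.filter_subset_filter _ hNM, g2⟩, ⟨Finset.filter_subset_filter _ hNM, g3⟩,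
      ⟨Finset.filter_subset_filter _ hNM, g4⟩⟩
  · rintro ⟨X, Y, Z⟩ hX
    simp only [Finset.mem_coe, Finset.mem_product, Finset.mem_powersetCard] at hX
    obtain ⟨⟨hX, hXc⟩, ⟨hY, hYc⟩, ⟨hZ, hZc⟩⟩ := hX
    have hsub : X ∪ Y ∪ Z ⊆ M := Finset.union_subset (Finset.union_subset
      (hX.trans (Finset.filter_subset _ _)) (hY.trans (Finset.filter_subset _ _)))
      (hZ.trans (Finset.filter_subset _ _))
    have k1 := hps s(0, 0) X Y Z hX hY hZ
    have k2 := hps s(1, 1) X Y Z hX hY hZ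
    have k3 := hps s(0, 1) X Y Z hX hY hZ
    rw [if_pos rfl] at k1
    rw [if_neg (by decide), if_pos rfl] at k2
    rw [if_neg (by decide), if_neg (by decide), if_pos rfl] at k3
    refine Finset.mem_filter.2 ⟨mem_Tset.2 ⟨h0.subset hsub, ?_, ?_, ?_, ?_⟩, hsub⟩
    · have := prt_union_card color (X ∪ Y ∪ Z)
      rw [k1, k2, k3, hXc, hYc, hZc] at this
      exact this
    · show (prt color s(0, 0) (X ∪ Y ∪ Z)).card = a
      rw [k1, hXc]
    · show (prt color s(1, 1) (X ∪ Y ∪ Z)).card = b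
      rw [k2, hYc]
    · show (prt color s(0, 1) (X ∪ Y ∪ Z)).card = c
      rw [k3, hZc]
  · intro N hN
    exact Tset_union (Finset.mem_filter.1 hN).1
  · rintro ⟨X, Y, Z⟩ hX
    simp only [Finset.mem_coe, Finset.mem_product, Finset.mem_powersetCard] at hX
    obtain ⟨⟨hX, hXc⟩, ⟨hY, hYc⟩, ⟨hZ, hZc⟩⟩ := hX
    have k1 := hps s(0, 0) X Y Z hX hY hZ
    have k2 := hps s(1, 1) X Y Z hX hY hZ
    have k3 := hps s(0, 1) X Y Z hX hY hZ
    rw [if_pos rfl] at k1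
    rw [if_neg (by decide), if_pos rfl] at k2
    rw [if_neg (by decide), if_neg (by decide), if_pos rfl] at k3
    simp only [k1, k2, k3]

theorem Tset_double {n : ℕ} {color : Fin n → Fin 3} {a b c p q m : ℕ} {F : Finset (Edge n)}
    (hF : F ∈ Tset color a b c) :
    (Tset color a b c).card * ((Tset color p q m).filter fun M => F ⊆ M).card =
      (Tset color p q m).card * (p.choose a * q.choose b * m.choose c) := by
  have h1 : ∀ N ∈ Tset color a b c, ((Tset color p q m).filter fun M => N ⊆ M).card
      = ((Tset color p q m).filter fun M => F ⊆ M).card := by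
    intro N hN
    have hle : ∀ F N, F ∈ Tset color a b c → N ∈ Tset color a b c →
        ((Tset color p q m).filter fun M => F ⊆ M).card ≤
        ((Tset color p q m).filter fun M => N ⊆ M).card := by
      intro F N hF hN
      obtain ⟨ρ, hρ, rfl⟩ := Tset_trans hF hN
      refine Finset.card_le_card_of_injOn (mv ρ) ?_ (mv_inj ρ).injOn
      intro M hM
      obtain ⟨hM1, hM2⟩ := Finset.mem_filter.1 hM
      exact Finset.mem_filter.2 ⟨Tset_mv hM1 ρ hρ, (mv_subset ρ).2 hM2⟩
    exact le_antisymm (hle _ _ hN hF) (hle _ _ hF hN)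
  have h2 := Finset.sum_card_bipartiteAbove_eq_sum_card_bipartiteBelow
    (s := Tset color a b c) (t := Tset color p q m) (fun N M : Finset (Edge n) => N ⊆ M)
  unfold Finset.bipartiteAbove Finset.bipartiteBelow at h2
  rw [Finset.sum_congr rfl h1, Finset.sum_congr rfl (fun M hM => Tset_sub_card hM)] at h2
  simpa using h2


open Polynomial in
theorem lagr (r : ℕ) : ∃ lam : ℕ → ℝ, ∀ q : ℝ[X], q.natDegree ≤ r →
    ∑ t ∈ Finset.range (r + 1), lam t * q.eval (t : ℝ) = q.eval (-1/2) := by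
  refine ⟨fun t => (Lagrange.basis (Finset.range (r+1)) (fun i : ℕ => (i : ℝ)) t).eval (-1/2), ?_⟩
  intro q hq
  have h1 := Lagrange.eq_interpolate (s := Finset.range (r+1)) (v := fun i : ℕ => (i : ℝ)) (f := q)
    (fun i _ j _ h => Nat.cast_injective h) (by
      rw [Finset.card_range]
      exact lt_of_le_of_lt Polynomial.degree_le_natDegree (by exact_mod_cast Nat.lt_succ_of_le hq))
  conv_rhs => rw [h1]
  rw [Lagrange.interpolate_apply, Polynomial.eval_finsetSum]
  refine Finset.sum_congr rfl fun t _ => ?_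
  rw [Polynomial.eval_mul, Polynomial.eval_C, mul_comm]

open Polynomial in
/-- polynomial `t ↦ binom(αt+β, a)` -/
noncomputable def bpoly (α β : ℝ) (a : ℕ) : ℝ[X] :=
  C ((a.factorial : ℝ)⁻¹) * (descPochhammer ℝ a).comp (C α * X + C β)

open Polynomial in
theorem bpoly_deg (α β : ℝ) (a : ℕ) : (bpoly α β a).natDegree ≤ a := by
  unfold bpoly
  refine le_trans (natDegree_C_mul_le _ _) ?_
  refine le_trans natDegree_comp_le ?_
  rw [descPochhammer_natDegree]
  have : (C α * X + C β).natDegree ≤ 1 := natDegree_linear_le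
  nlinarith

theorem bpoly_eval (α β : ℝ) (a m : ℕ) (t : ℝ) (h : α * t + β = m) :
    (bpoly α β a).eval t = (m.choose a : ℝ) := by
  unfold bpoly
  rw [Polynomial.eval_mul, Polynomial.eval_C, Polynomial.eval_comp]
  have : Polynomial.eval t (Polynomial.C α * Polynomial.X + Polynomial.C β) = (m:ℝ) := by
    simp [h]
  rw [this, descPochhammer_eval_eq_descFactorial, Nat.descFactorial_eq_factorial_mul_choose]
  have := Nat.factorial_ne_zero a
  push_cast
  field_simp

theorem bpoly_nonneg (α β : ℝ) (a : ℕ) (t : ℝ) (h : (a:ℝ) - 1 ≤ α * t + β) :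
    0 ≤ (bpoly α β a).eval t := by
  unfold bpoly
  rw [Polynomial.eval_mul, Polynomial.eval_C, Polynomial.eval_comp]
  have : Polynomial.eval t (Polynomial.C α * Polynomial.X + Polynomial.C β) = α * t + β := by
    simp
  rw [this]
  exact mul_nonneg (by positivity) (descPochhammer_nonneg h)

theorem bpoly_nonneg_zero (α β : ℝ) (a : ℕ) (t : ℝ) (h : α * t + β = 0) :
    0 ≤ (bpoly α β a).eval t := by
  rcases Nat.eq_zero_or_pos a with rfl | ha
  · apply bpoly_nonneg; rw [h]; norm_num
  · rw [bpoly_eval α β a 0 t (by simpa using h)]; positivity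

theorem lam_exists (r : ℕ) (hr : 1 ≤ r) : ∃ lam : ℕ → ℝ,
    (∑ t ∈ Finset.range (r + 1), lam t = 1) ∧
    (∑ t ∈ Finset.range (r + 1), lam t * (2 * t + 1) = 0) ∧
    ∀ r' a b c, r ≤ r' → a + b + c ≤ r →
      0 ≤ ∑ t ∈ Finset.range (r + 1),
        lam t * ((r - t).choose a * (r' - t).choose b * (2 * t + 1).choose c : ℕ) := by
  obtain ⟨lam, hl⟩ := lagr r
  refine ⟨lam, ?_, ?_, ?_⟩
  · have := hl 1 (by simp)
    simpa using this
  · have := hl (Polynomial.C 2 * Polynomial.X + Polynomial.C 1)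
      (Polynomial.natDegree_linear_le.trans hr)
    simp only [Polynomial.eval_add, Polynomial.eval_mul, Polynomial.eval_C, Polynomial.eval_X] at this
    rw [this]; norm_num
  · intro r' a b c hrr habc
    have h1 := hl (bpoly (-1) r a * bpoly (-1) r' b * bpoly 2 1 c) (by
      refine le_trans Polynomial.natDegree_mul_le ?_
      refine le_trans (add_le_add Polynomial.natDegree_mul_le le_rfl) ?_
      have := bpoly_deg (-1) r a
      have := bpoly_deg (-1) r' b
      have := bpoly_deg 2 1 c
      omega)
    have h2 : ∑ t ∈ Finset.range (r + 1),
        lam t * ((r - t).choose a * (r' - t).choose b * (2 * t + 1).choose c : ℕ)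
        = ∑ t ∈ Finset.range (r + 1), lam t *
          (bpoly (-1) r a * bpoly (-1) r' b * bpoly 2 1 c).eval (t:ℝ) := by
      refine Finset.sum_congr rfl fun t ht => ?_
      have ht' : t ≤ r := Nat.lt_succ_iff.1 (Finset.mem_range.1 ht)
      rw [Polynomial.eval_mul, Polynomial.eval_mul,
        bpoly_eval (-1) r a (r - t) t (by rw [Nat.cast_sub ht']; ring),
        bpoly_eval (-1) r' b (r' - t) t (by rw [Nat.cast_sub (ht'.trans hrr)]; ring),
        bpoly_eval 2 1 c (2 * t + 1) t (by push_cast; ring)]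
      push_cast; ring
    rw [h2, h1, Polynomial.eval_mul, Polynomial.eval_mul]
    have ha : (a:ℝ) ≤ r := by exact_mod_cast (by omega : a ≤ r)
    have hb : (b:ℝ) ≤ r' := by exact_mod_cast (by omega : b ≤ r')
    refine mul_nonneg (mul_nonneg (bpoly_nonneg _ _ _ _ ?_) (bpoly_nonneg _ _ _ _ ?_))
      (bpoly_nonneg_zero _ _ _ _ (by norm_num))
    · linarith
    · linarith


theorem fin_count (n x y : ℕ) (hy : y ≤ n) :
    (Finset.univ.filter fun v : Fin n => x ≤ v.1 ∧ v.1 < y).card = y - x := by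
  rw [← Nat.card_Ico, ← Finset.card_map Fin.valEmbedding]
  congr 1
  ext v
  simp only [Finset.mem_map, Finset.mem_filter, Finset.mem_univ, true_and, Fin.valEmbedding_apply,
    Finset.mem_Ico]
  constructor
  · rintro ⟨w, hw, rfl⟩; exact hw
  · intro h; exact ⟨⟨v, by omega⟩, h, rfl⟩

/-- nodes covered by an edge set -/
def verts {n : ℕ} (D : Finset (Edge n)) : Finset (Fin n) := D.biUnion fun e => e.1.toFinset

theorem mem_verts {n : ℕ} (D : Finset (Edge n)) (v : Fin n) :
    v ∈ verts D ↔ ∃ e ∈ D, v ∈ e.1 := by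
  simp only [verts, Finset.mem_biUnion, Sym2.mem_toFinset]

theorem verts_card {n : ℕ} (D : Finset (Edge n)) (hD : IsMatching D) :
    (verts D).card = 2 * D.card := by
  unfold verts
  rw [Finset.card_biUnion]
  · rw [Finset.sum_congr rfl (fun e _ => Sym2.card_toFinset_of_not_isDiag e.1 e.2)]
    simp [mul_comm]
  · intro e he f hf hne
    refine Finset.disjoint_left.2 ?_
    intro v hv hv'
    exact hD e he f hf hne v ⟨Sym2.mem_toFinset.1 hv, Sym2.mem_toFinset.1 hv'⟩

/-- the coloring: first `2r+1` nodes, next nodes up to `2ℓ`, the rest -/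
def color3 (n r ℓ : ℕ) (v : Fin n) : Fin 3 :=
  if v.1 < 2 * r + 1 then 0 else if v.1 < 2 * ℓ then 1 else 2

theorem color3_zero {n r ℓ : ℕ} {v : Fin n} : color3 n r ℓ v = 0 ↔ v.1 < 2 * r + 1 := by
  unfold color3
  split_ifs <;> simp_all

theorem color3_one {n r ℓ : ℕ} {v : Fin n} :
    color3 n r ℓ v = 1 ↔ 2 * r + 1 ≤ v.1 ∧ v.1 < 2 * ℓ := by
  unfold color3
  split_ifs with h1 h2
  · simp; omega
  · simp; omega
  · simp; omega

theorem mem_ety {n : ℕ} {C : Type} (color : Fin n → C) (e : Edge n) (v : Fin n) (hv : v ∈ e.1) :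
    color v ∈ ety color e := Sym2.mem_map.2 ⟨v, hv, rfl⟩

theorem prt_card_zero {n r ℓ : ℕ} (h2 : 2 * r + 1 ≤ n)
    (M : Finset (Edge n)) (hM : IsMatching M) : (prt (color3 n r ℓ) s(0, 0) M).card ≤ r := by
  have h1 := verts_card (prt (color3 n r ℓ) s(0, 0) M) (hM.subset (Finset.filter_subset _ _))
  have h3 : (verts (prt (color3 n r ℓ) s(0, 0) M)).card ≤ 2 * r + 1 - 0 := by
    rw [← fin_count n 0 (2 * r + 1) h2]
    apply Finset.card_le_card
    intro v hv
    obtain ⟨e, he, hve⟩ := (mem_verts _ _).1 hv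
    have h4 := mem_ety (color3 n r ℓ) e v hve
    rw [(Finset.mem_filter.1 he).2] at h4
    have h5 : color3 n r ℓ v = 0 := by simpa using h4
    rw [color3_zero] at h5
    simp; omega
  omega

theorem prt_card_one {n r r' ℓ : ℕ} (hl : r + r' + 1 = ℓ) (h2 : 2 * ℓ ≤ n)
    (M : Finset (Edge n)) (hM : IsMatching M) : (prt (color3 n r ℓ) s(1, 1) M).card ≤ r' := by
  have h1 := verts_card (prt (color3 n r ℓ) s(1, 1) M) (hM.subset (Finset.filter_subset _ _))
  have h3 : (verts (prt (color3 n r ℓ) s(1, 1) M)).card ≤ 2 * ℓ - (2 * r + 1) := by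
    rw [← fin_count n (2 * r + 1) (2 * ℓ) h2]
    apply Finset.card_le_card
    intro v hv
    obtain ⟨e, he, hve⟩ := (mem_verts _ _).1 hv
    have h4 := mem_ety (color3 n r ℓ) e v hve
    rw [(Finset.mem_filter.1 he).2] at h4
    have h5 : color3 n r ℓ v = 1 := by simpa using h4
    rw [color3_one] at h5
    simp; omega
  omega

theorem Tset_lt {n r ℓ a b c : ℕ} (hr : 2 * r + 1 ≤ 2 * ℓ) {M : Finset (Edge n)}
    (hM : M ∈ Tset (color3 n r ℓ) a b c) (e : Edge n) (he : e ∈ M) (v : Fin n) (hv : v ∈ e.1) :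
    v.1 < 2 * ℓ := by
  have h4 := mem_ety (color3 n r ℓ) e v hv
  have h5 : color3 n r ℓ v = 0 ∨ color3 n r ℓ v = 1 := by
    rcases Tset_types hM e he with h | h | h <;> rw [h] at h4 <;> simp at h4
      <;> tauto
  rw [color3_zero, color3_one] at h5
  omega

theorem Tset_cover {n r ℓ a b c : ℕ} (hr : 2 * r + 1 ≤ 2 * ℓ) (hn : 2 * ℓ ≤ n)
    (habc : a + b + c = ℓ) {M : Finset (Edge n)}
    (hM : M ∈ Tset (color3 n r ℓ) a b c) (v : Fin n) (hv : v.1 < 2 * ℓ) : ∃ e ∈ M, v ∈ e.1 := by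
  obtain ⟨h0, h1, _⟩ := mem_Tset.1 hM
  rw [← mem_verts]
  have h2 : verts M = Finset.univ.filter fun v : Fin n => 0 ≤ v.1 ∧ v.1 < 2 * ℓ := by
    apply Finset.eq_of_subset_of_card_le
    · intro w hw
      obtain ⟨e, he, hwe⟩ := (mem_verts _ _).1 hw
      simpa using Tset_lt hr hM e he w hwe
    · rw [fin_count n 0 _ hn, verts_card M h0, h1, habc]; omega
  rw [h2]; simpa using hv

theorem Tset_nonempty {n r r' ℓ p q m : ℕ} (h1 : 2 * p + m = 2 * r + 1)
    (h2 : 2 * q + m = 2 * r' + 1) (hl : r + r' + 1 = ℓ) (hn : 2 * ℓ ≤ n) :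
    (Tset (color3 n r ℓ) p q m).Nonempty := by
  have hpqm : p + q + m = ℓ := by omega
  let x : ℕ → ℕ := fun i => if i < p then 2 * i else if i < p + m then p + i else
    2 * r + 1 + m + 2 * (i - p - m)
  let y : ℕ → ℕ := fun i => if i < p then 2 * i + 1 else if i < p + m then 2 * r + 1 + (i - p) else
    2 * r + 2 + m + 2 * (i - p - m)
  have hx : ∀ i, i < ℓ → x i < n := by
    intro i hi
    simp only [x]
    split_ifs <;> omega
  have hy : ∀ i, i < ℓ → y i < n := by
    intro i hi
    simp only [y]
    split_ifs <;> omega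
  have hxy : ∀ i, i < ℓ → x i ≠ y i := by
    intro i hi
    simp only [x, y]
    split_ifs <;> omega
  let E : Fin ℓ → Edge n := fun i => ⟨s(⟨x i, hx i i.2⟩, ⟨y i, hy i i.2⟩), by
    rw [Sym2.mk_isDiag_iff, Fin.mk.injEq]
    exact hxy i i.2⟩
  have hmem : ∀ (i : Fin ℓ) (v : Fin n), v ∈ (E i).1 ↔ v.1 = x i ∨ v.1 = y i := by
    intro i v
    simp only [E, Sym2.mem_iff, Fin.ext_iff]
  have huniq : ∀ (i j : Fin ℓ) (v : Fin n), v ∈ (E i).1 → v ∈ (E j).1 → i = j := by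
    intro i j v hi hj
    rw [hmem] at hi hj
    have hi2 := i.2
    have hj2 := j.2
    simp only [x, y] at hi hj
    apply Fin.ext
    split_ifs at hi hj <;> omega
  have hinj : Function.Injective E := by
    intro i j hij
    have h3 : (⟨x i, hx i i.2⟩ : Fin n) ∈ (E i).1 := by rw [hmem]; left; rfl
    exact huniq i j _ h3 (by rw [← hij]; exact h3)
  have hty : ∀ i : Fin ℓ, ety (color3 n r ℓ) (E i) =
      if i.1 < p then s(0, 0) else if i.1 < p + m then s(0, 1) else s(1, 1) := by
    intro i
    have hi2 := i.2
    have e1 : ety (color3 n r ℓ) (E i) = s(color3 n r ℓ ⟨x i, hx i i.2⟩, color3 n r ℓ ⟨y i, hy i i.2⟩) :=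
      rfl
    rw [e1]
    split_ifs with c1 c2
    · rw [color3_zero.2, color3_zero.2]
      · simp only [y, if_pos c1]; omega
      · simp only [x, if_pos c1]; omega
    · rw [color3_zero.2, color3_one.2]
      · simp only [y, if_neg c1, if_pos c2]; omega
      · simp only [x, if_neg c1, if_pos c2]; omega
    · rw [color3_one.2, color3_one.2]
      · simp only [y, if_neg c1, if_neg c2]; omega
      · simp only [x, if_neg c1, if_neg c2]; omega
  have hprt : ∀ θ, (prt (color3 n r ℓ) θ (Finset.univ.image E)).card
      = (Finset.univ.filter fun i : Fin ℓ => ety (color3 n r ℓ) (E i) = θ).card := by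
    intro θ
    unfold prt
    rw [Finset.filter_image, Finset.card_image_of_injective _ hinj]
  have d1 : (s(0, 0) : Sym2 (Fin 3)) ≠ s(1, 1) := by decide
  have d2 : (s(0, 0) : Sym2 (Fin 3)) ≠ s(0, 1) := by decide
  have d3 : (s(1, 1) : Sym2 (Fin 3)) ≠ s(0, 1) := by decide
  refine ⟨Finset.univ.image E, mem_Tset.2 ⟨?_, ?_, ?_, ?_, ?_⟩⟩
  · intro e he f hf hne v hv
    obtain ⟨i, _, rfl⟩ := Finset.mem_image.1 he
    obtain ⟨j, _, rfl⟩ := Finset.mem_image.1 hf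
    exact hne (by rw [huniq i j v hv.1 hv.2])
  · rw [Finset.card_image_of_injective _ hinj]; simp [hpqm]
  · have h3 := fin_count ℓ 0 p (by omega)
    rw [hprt, Finset.filter_congr (q := fun i : Fin ℓ => 0 ≤ i.1 ∧ i.1 < p), h3]
    · rfl
    · intro i _
      rw [hty]
      split_ifs <;> grind
  · have h3 := fin_count ℓ (p + m) ℓ le_rfl
    rw [hprt, Finset.filter_congr (q := fun i : Fin ℓ => p + m ≤ i.1 ∧ i.1 < ℓ), h3]
    · omega
    · intro i _
      rw [hty]
      have := i.2
      split_ifs <;> grind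
  · have h3 := fin_count ℓ p (p + m) (by omega)
    rw [hprt, Finset.filter_congr (q := fun i : Fin ℓ => p ≤ i.1 ∧ i.1 < p + m), h3]
    · omega
    · intro i _
      rw [hty]
      split_ifs <;> grind


/-- the families of matchings used -/
noncomputable def Om (n r r' ℓ t : ℕ) : Finset (Finset (Edge n)) :=
  Tset (color3 n r ℓ) (r - t) (r' - t) (2 * t + 1)

theorem Om_sum {r r' ℓ t : ℕ} (hl : r + r' + 1 = ℓ) (hrr : r ≤ r') (ht : t ≤ r) :
    (r - t) + (r' - t) + (2 * t + 1) = ℓ := by omega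

theorem Om_pos {n r r' ℓ t : ℕ} (hl : r + r' + 1 = ℓ) (hrr : r ≤ r') (hn : 2 * ℓ ≤ n)
    (ht : t ≤ r) : (0:ℝ) < (Om n r r' ℓ t).card := by
  have : (Om n r r' ℓ t).Nonempty := Tset_nonempty (r' := r') (by omega) (by omega) hl hn
  exact_mod_cast this.card_pos

theorem sub_type {n : ℕ} {color : Fin n → Fin 3} {a b c : ℕ} {F M : Finset (Edge n)}
    (hM : M ∈ Tset color a b c) (hF : F ⊆ M) :
    F ∈ Tset color (prt color s(0, 0) F).card (prt color s(1, 1) F).card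
      (prt color s(0, 1) F).card := by
  refine mem_Tset.2 ⟨(mem_Tset.1 hM).1.subset hF, ?_, rfl, rfl, rfl⟩
  rw [← prt_union_card]
  congr 1
  ext e
  simp only [Finset.mem_union, prt, Finset.mem_filter]
  constructor
  · intro he
    have := Tset_types hM e (hF he)
    tauto
  · tauto

open Classical in
theorem core_ineq {n r r' ℓ : ℕ} (hl : r + r' + 1 = ℓ) (hrr : r ≤ r') (hn : 2 * ℓ ≤ n)
    (lam : ℕ → ℝ)
    (hlam : ∀ a b c, a + b + c ≤ r →
      0 ≤ ∑ t ∈ Finset.range (r + 1),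
        lam t * ((r - t).choose a * (r' - t).choose b * (2 * t + 1).choose c : ℕ))
    (H : Subgroup (Equiv.Perm (Fin n))) (U : Finset (Fin n)) (hU : U.card ≤ r)
    (hC : ∀ a b c, a ∉ U → b ∉ U → c ∉ U → a ≠ b → b ≠ c → a ≠ c → Cyc H a b c)
    (S : Finset (Edge n) → ℝ) (hS0 : ∀ M, IsMatching M → M.card = ℓ → 0 ≤ S M)
    (hSH : ∀ M, IsMatching M → M.card = ℓ → ∀ ρ ∈ H, S (mv ρ M) = S M) :
    0 ≤ ∑ t ∈ Finset.range (r + 1), ∑ M ∈ Om n r r' ℓ t, lam t / (Om n r r' ℓ t).card * S M := by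
  have hOm : ∀ t ≤ r, ∀ M ∈ Om n r r' ℓ t, IsMatching M ∧ M.card = ℓ := by
    intro t ht M hM
    obtain ⟨h0, h1, _⟩ := mem_Tset.1 hM
    exact ⟨h0, by rw [h1, Om_sum hl hrr ht]⟩
  have hφ : ∀ F : Finset (Edge n), ∃ x : ℝ, 0 ≤ x ∧
      ∀ t ≤ r, ∀ M ∈ Om n r r' ℓ t, tpart U M = F → S M = x := by
    intro F
    by_cases hF : ∃ t ≤ r, ∃ M ∈ Om n r r' ℓ t, tpart U M = F
    · obtain ⟨t, ht, M, hM, hMF⟩ := hF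
      obtain ⟨hm, hc⟩ := hOm t ht M hM
      refine ⟨S M, hS0 M hm hc, ?_⟩
      intro t' ht' M' hM' hMF'
      obtain ⟨hm', hc'⟩ := hOm t' ht' M' hM'
      obtain ⟨ρ, hρ, hρe⟩ := dep H U hC M M' hm hm' (by rw [hc, hc']) (by omega)
        (by rw [hMF, hMF'])
      rw [← hρe, hSH M hm hc ρ hρ]
    · push Not at hF
      exact ⟨0, le_rfl, fun t ht M hM h => absurd h (hF t ht M hM)⟩
  choose φ hφ0 hφS using hφ
  let FF : Finset (Finset (Edge n)) :=
    ((Finset.range (r + 1)).biUnion (Om n r r' ℓ)).image (tpart U)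
  have hFF : ∀ F ∈ FF, ∃ t ≤ r, ∃ M ∈ Om n r r' ℓ t, tpart U M = F := by
    intro F hF
    obtain ⟨M, hM, rfl⟩ := Finset.mem_image.1 hF
    obtain ⟨t, ht, hM⟩ := Finset.mem_biUnion.1 hM
    exact ⟨t, Nat.lt_succ_iff.1 (Finset.mem_range.1 ht), M, hM, rfl⟩
  have hsum : ∀ t ∈ Finset.range (r + 1),
      ∑ M ∈ Om n r r' ℓ t, lam t / (Om n r r' ℓ t).card * S M =
      ∑ F ∈ FF, φ F * (lam t * (((Om n r r' ℓ t).filter fun M => tpart U M = F).card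
        / (Om n r r' ℓ t).card)) := by
    intro t ht
    have ht' : t ≤ r := Nat.lt_succ_iff.1 (Finset.mem_range.1 ht)
    rw [← Finset.sum_fiberwise_of_maps_to (t := FF) (g := tpart U) (fun M hM =>
      Finset.mem_image_of_mem _ (Finset.mem_biUnion.2 ⟨t, ht, hM⟩))]
    refine Finset.sum_congr rfl fun F _ => ?_
    rw [Finset.sum_congr rfl (g := fun _ => lam t / (Om n r r' ℓ t).card * φ F) (fun M hM => by
      obtain ⟨h1, h2⟩ := Finset.mem_filter.1 hM
      rw [hφS F t ht' M h1 h2])]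
    rw [Finset.sum_const, nsmul_eq_mul]
    ring
  rw [Finset.sum_congr rfl hsum, Finset.sum_comm]
  refine Finset.sum_nonneg fun F hF => ?_
  rw [← Finset.mul_sum]
  refine mul_nonneg (hφ0 F) ?_
  obtain ⟨t0, ht0, M0, hM0, hMF⟩ := hFF F hF
  have hFM0 : F ⊆ M0 := by rw [← hMF]; exact Finset.filter_subset _ _
  have hFT := sub_type hM0 hFM0
  have hFtouch : ∀ e ∈ F, touch U e := fun e he => by
    rw [← hMF] at he; exact (Finset.mem_filter.1 he).2
  have hFcard := touch_card U F (mem_Tset.1 hFT).1 hFtouch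
  have habc := (mem_Tset.1 hFT).2.1
  set a := (prt (color3 n r ℓ) s(0, 0) F).card
  set b := (prt (color3 n r ℓ) s(1, 1) F).card
  set c := (prt (color3 n r ℓ) s(0, 1) F).card
  have hTpos : (0:ℝ) < (Tset (color3 n r ℓ) a b c).card := by
    exact_mod_cast Finset.card_pos.2 ⟨F, hFT⟩
  have hterm : ∀ t ∈ Finset.range (r + 1),
      lam t * ((((Om n r r' ℓ t).filter fun M => tpart U M = F).card : ℝ) / (Om n r r' ℓ t).card)
      = ((Tset (color3 n r ℓ) a b c).card : ℝ)⁻¹ *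
        (lam t * ((r - t).choose a * (r' - t).choose b * (2 * t + 1).choose c : ℕ)) := by
    intro t ht
    have ht' : t ≤ r := Nat.lt_succ_iff.1 (Finset.mem_range.1 ht)
    have hO := Om_pos hl hrr hn ht'
    have hfil : ((Om n r r' ℓ t).filter fun M => tpart U M = F)
        = ((Om n r r' ℓ t).filter fun M => F ⊆ M) := by
      apply Finset.filter_congr
      intro M hM
      constructor
      · intro h; rw [← h]; exact Finset.filter_subset _ _
      · intro h
        apply Finset.Subset.antisymm
        · intro e he
          obtain ⟨heM, u, huU, hue⟩ := Finset.mem_filter.1 he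
          have hu := Tset_lt (by omega) hM e heM u hue
          obtain ⟨e0, he0, hue0⟩ := Tset_cover (by omega) hn (Om_sum hl hrr ht0) hM0 u hu
          have he0F : e0 ∈ F := by
            rw [← hMF]; exact Finset.mem_filter.2 ⟨he0, u, huU, hue0⟩
          by_cases hee : e = e0
          · rw [hee]; exact he0F
          · exact absurd ⟨hue, hue0⟩ ((hOm t ht' M hM).1 e heM e0 (h he0F) hee u)
        · intro e he
          exact Finset.mem_filter.2 ⟨h he, hFtouch e he⟩
    have hdc : (Tset (color3 n r ℓ) a b c).card *
        ((Om n r r' ℓ t).filter fun M => F ⊆ M).card = (Om n r r' ℓ t).card *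
        ((r - t).choose a * (r' - t).choose b * (2 * t + 1).choose c) := by
      have := Tset_double (p := r - t) (q := r' - t) (m := 2 * t + 1) hFT
      unfold Om
      convert this
    have hdc' : ((Tset (color3 n r ℓ) a b c).card : ℝ) *
        (((Om n r r' ℓ t).filter fun M => F ⊆ M).card : ℝ) = ((Om n r r' ℓ t).card : ℝ) *
        (((r - t).choose a * (r' - t).choose b * (2 * t + 1).choose c : ℕ) : ℝ) := by
      exact_mod_cast hdc
    rw [hfil]
    field_simp
    linear_combination lam t * hdc'
  rw [Finset.sum_congr rfl hterm, ← Finset.mul_sum]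
  exact mul_nonneg (inv_nonneg.2 hTpos.le) (hlam a b c (by omega))


open Classical in
/-- the linear functional summing the coordinates of edges not inside a color class -/
noncomputable def Lam {n : ℕ} (color : Fin n → Fin 3) : (Edge n → ℝ) →ₗ[ℝ] ℝ :=
  ∑ e ∈ Finset.univ.filter (fun e : Edge n => ety color e ≠ s(0, 0) ∧ ety color e ≠ s(1, 1)),
    LinearMap.proj e

open Classical in
theorem Lam_charVec {n : ℕ} (color : Fin n → Fin 3) (M : Finset (Edge n)) :
    Lam color (charVec M) + ((prt color s(0, 0) M).card : ℝ) + ((prt color s(1, 1) M).card : ℝ)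
      = (M.card : ℝ) := by
  have h1 : Lam color (charVec M) =
      ((M.filter fun e => ety color e ≠ s(0, 0) ∧ ety color e ≠ s(1, 1)).card : ℝ) := by
    unfold Lam charVec
    simp only [LinearMap.sum_apply, LinearMap.proj_apply, Finset.sum_ite_mem]
    rw [Finset.sum_const, nsmul_eq_mul, mul_one]
    congr 2
    ext e
    simp only [Finset.mem_inter, Finset.mem_filter, Finset.mem_univ, true_and]
    tauto
  have d1 : (s(0, 0) : Sym2 (Fin 3)) ≠ s(1, 1) := by decide
  have h2 : M.card = (M.filter fun e => ety color e ≠ s(0, 0) ∧ ety color e ≠ s(1, 1)).card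
      + (prt color s(0, 0) M).card + (prt color s(1, 1) M).card := by
    rw [← Finset.card_union_of_disjoint, ← Finset.card_union_of_disjoint]
    · congr 1
      ext e
      simp only [prt, Finset.mem_union, Finset.mem_filter]
      tauto
    · rw [Finset.disjoint_left]
      intro e he he'
      simp only [prt, Finset.mem_union, Finset.mem_filter] at he he'
      rcases he with he | he
      · exact he.2.2 he'.2
      · exact d1 (he.2.symm.trans he'.2)
    · rw [Finset.disjoint_left]
      intro e he he'
      simp only [prt, Finset.mem_filter] at he he'
      exact he.2.1 he'.2
  rw [h1]
  exact_mod_cast h2.symm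

theorem Lam_ge {n r r' ℓ : ℕ} (hl : r + r' + 1 = ℓ) (hn : 2 * ℓ ≤ n) :
    ∀ x ∈ matchingPolytope n ℓ, 1 ≤ Lam (color3 n r ℓ) x := by
  have h1 : matchingPolytope n ℓ ⊆ {x | 1 ≤ Lam (color3 n r ℓ) x} := by
    refine convexHull_min ?_ (convex_halfSpace_ge (Lam (color3 n r ℓ)).isLinear 1)
    rintro _ ⟨M, hM, hc, rfl⟩
    have h2 := Lam_charVec (color3 n r ℓ) M
    have h3 : ((prt (color3 n r ℓ) s(0, 0) M).card : ℝ) ≤ r := by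
      exact_mod_cast prt_card_zero (by omega) M hM
    have h4 : ((prt (color3 n r ℓ) s(1, 1) M).card : ℝ) ≤ r' := by
      exact_mod_cast prt_card_one hl hn M hM
    have h5 : (M.card : ℝ) = r + r' + 1 := by rw [hc, ← hl]; push_cast; ring
    show 1 ≤ Lam (color3 n r ℓ) (charVec M)
    linarith
  exact fun x hx => h1 hx

theorem no_section {n r r' ℓ : ℕ} (hr : 1 ≤ r) (hl : r + r' + 1 = ℓ) (hrr : r ≤ r')
    (hn : 2 * ℓ ≤ n) {I : Type} (s : (Edge n → ℝ) → I → ℝ)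
    (h1 : ∀ x ∈ matchingPolytope n ℓ, ∀ j, 0 ≤ s x j)
    (h3 : ∀ (X : Type) [Fintype X] (a : X → ℝ) (v : X → (Edge n → ℝ)),
        (∀ x, v x ∈ matchingPolytope n ℓ) → ∑ x, a x = 1 →
        (∀ j, 0 ≤ ∑ x, a x * s (v x) j) → ∑ x, a x • v x ∈ matchingPolytope n ℓ)
    (hH : ∀ j, ∃ (H : Subgroup (Equiv.Perm (Fin n))) (U : Finset (Fin n)), U.card ≤ r ∧
      (∀ a b c, a ∉ U → b ∉ U → c ∉ U → a ≠ b → b ≠ c → a ≠ c → Cyc H a b c) ∧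
      ∀ ρ ∈ H, ∀ x ∈ matchingPolytope n ℓ, s (edgeAction ρ x) j = s x j) : False := by
  obtain ⟨lam, hl1, hl2, hl3⟩ := lam_exists r hr
  have hOm : ∀ t ≤ r, ∀ M ∈ Om n r r' ℓ t, IsMatching M ∧ M.card = ℓ := by
    intro t ht M hM
    obtain ⟨g0, g1, _⟩ := mem_Tset.1 hM
    exact ⟨g0, by rw [g1, Om_sum hl hrr ht]⟩
  have hmem : ∀ M : Finset (Edge n), IsMatching M → M.card = ℓ →
      charVec M ∈ matchingPolytope n ℓ := fun M hM hc =>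
    subset_convexHull ℝ _ ⟨M, hM, hc, rfl⟩
  let X : Type := Σ t : Fin (r + 1), {M // M ∈ Om n r r' ℓ t.1}
  have hXsum : ∀ g : ℕ → Finset (Edge n) → ℝ, ∑ x : X, g x.1.1 x.2.1 =
      ∑ t ∈ Finset.range (r + 1), ∑ M ∈ Om n r r' ℓ t, g t M := by
    intro g
    rw [Fintype.sum_sigma, Finset.sum_range]
    refine Finset.sum_congr rfl fun t _ => ?_
    exact Finset.sum_coe_sort (Om n r r' ℓ t.1) (fun M => g t.1 M)
  have hle : ∀ x : X, x.1.1 ≤ r := fun x => Nat.lt_succ_iff.1 x.1.2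
  have hz := h3 X (fun x => lam x.1.1 / (Om n r r' ℓ x.1.1).card) (fun x => charVec x.2.1)
    (fun x => hmem _ (hOm _ (hle x) _ x.2.2).1 (hOm _ (hle x) _ x.2.2).2) (by
      rw [hXsum (fun t _ => lam t / (Om n r r' ℓ t).card), ← hl1]
      refine Finset.sum_congr rfl fun t ht => ?_
      have ht' : t ≤ r := Nat.lt_succ_iff.1 (Finset.mem_range.1 ht)
      have := (Om_pos hl hrr hn ht').ne'
      rw [Finset.sum_const, nsmul_eq_mul]
      field_simp) (by
      intro j
      obtain ⟨H, U, hU, hC, hHs⟩ := hH j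
      rw [hXsum (fun t M => lam t / (Om n r r' ℓ t).card * s (charVec M) j)]
      refine core_ineq hl hrr hn lam (fun a b c h => hl3 r' a b c hrr h) H U hU hC
        (fun M => s (charVec M) j) (fun M hM hc => h1 _ (hmem M hM hc) j) ?_
      intro M hM hc ρ hρ
      rw [← edgeAction_charVec]
      exact hHs ρ hρ _ (hmem M hM hc))
  have hge := Lam_ge hl hn _ hz
  have hzero : Lam (color3 n r ℓ)
      (∑ x : X, (lam x.1.1 / (Om n r r' ℓ x.1.1).card) • charVec x.2.1) = 0 := by
    rw [map_sum]
    simp only [map_smul, smul_eq_mul]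
    rw [hXsum (fun t M => lam t / (Om n r r' ℓ t).card * Lam (color3 n r ℓ) (charVec M)), ← hl2]
    refine Finset.sum_congr rfl fun t ht => ?_
    have ht' : t ≤ r := Nat.lt_succ_iff.1 (Finset.mem_range.1 ht)
    have hp := (Om_pos hl hrr hn ht').ne'
    rw [Finset.sum_congr rfl (g := fun _ => lam t / (Om n r r' ℓ t).card * (2 * t + 1)) (fun M hM => by
      have e1 := Lam_charVec (color3 n r ℓ) M
      obtain ⟨_, g1, g2, g3, _⟩ := mem_Tset.1 hM
      rw [g1, g2, g3] at e1
      push_cast at e1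
      congr 1
      linarith)]
    rw [Finset.sum_const, nsmul_eq_mul]
    field_simp
  rw [hzero] at hge
  linarith


/-- Corollary 3.3.  For every constant `c > 0` and every `k` there is
`n₀` such that for all `n ≥ n₀` and every `ℓ` with `c·log₂ n ≤ ℓ ≤ n/2`, every
isometry-symmetric (w.r.t. `S_n`) extension of `P_match(ℓ,n)` — given as the solution
set of linear equations together with `f` linear inequalities — satisfies `f > n^k`.
In particular there is no symmetric extended formulation of size polynomial in `n`. -/
theorem statement7 (c : ℝ) (hc : 0 < c) (k : ℕ) :
    ∃ n₀ : ℕ, ∀ n : ℕ, n₀ ≤ n →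
      ∀ ℓ d g f : ℕ, c * Real.logb 2 (n : ℝ) ≤ (ℓ : ℝ) → 2 * ℓ ≤ n →
        ∀ (Aeq : Fin g → Fin d → ℝ) (beq : Fin g → ℝ)
          (A : Fin f → Fin d → ℝ) (b : Fin f → ℝ)
          (Q : Set (Fin d → ℝ)),
          Q = {y : Fin d → ℝ |
              (∀ i : Fin g, ∑ j, Aeq i j * y j = beq i) ∧
              (∀ i : Fin f, ∑ j, A i j * y j ≤ b i)} →
          ∀ p : (Fin d → ℝ) →ᵃ[ℝ] (Edge n → ℝ),
            p '' Q = matchingPolytope n ℓ →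
            (∀ π : Equiv.Perm (Fin n),
              ∃ (U : Matrix (Fin d) (Fin d) ℝ) (u : Fin d → ℝ),
                U * U.transpose = 1 ∧
                (fun y : Fin d → ℝ => U.mulVec y + u) '' Q = Q ∧
                ∀ y ∈ Q, p (U.mulVec y + u) = edgeAction π (p y)) →
            ((n : ℝ) ^ k < (f : ℝ)) := by
  classical
  obtain ⟨n₁, hn₁⟩ := gl_final k
  refine ⟨max n₁ (2 ^ ⌈((2 * (k + 1) + 1 : ℕ) : ℝ) / c⌉₊), ?_⟩
  intro n hn ℓ d g f hlog hln Aeq beq A b Q hQ p hp hsym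
  by_contra hcon
  have hfn : f ≤ n ^ k := by
    push Not at hcon
    exact_mod_cast hcon
  have hnn₁ : n₁ ≤ n := le_trans (le_max_left _ _) hn
  have hn2 : 2 ^ ⌈((2 * (k + 1) + 1 : ℕ) : ℝ) / c⌉₊ ≤ n := le_trans (le_max_right _ _) hn
  have hℓ : 2 * (k + 1) + 1 ≤ ℓ := by
    have hnpos : (0:ℝ) < n := by
      have : 0 < n := lt_of_lt_of_le (by positivity) hn2
      exact_mod_cast this
    have h1 : ((2 * (k + 1) + 1 : ℕ) : ℝ) / c ≤ Real.logb 2 n := by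
      rw [Real.le_logb_iff_rpow_le (by norm_num) hnpos]
      refine le_trans (Real.rpow_le_rpow_of_exponent_le (by norm_num) (Nat.le_ceil _)) ?_
      rw [Real.rpow_natCast]
      exact_mod_cast hn2
    rw [div_le_iff₀ hc] at h1
    have h2 : ((2 * (k + 1) + 1 : ℕ) : ℝ) ≤ ℓ := by linarith
    exact_mod_cast h2
  have hl : (k + 1) + (ℓ - 1 - (k + 1)) + 1 = ℓ := by omega
  have hrr : k + 1 ≤ ℓ - 1 - (k + 1) := by omega
  have hQne : Q.Nonempty := by
    obtain ⟨M, hM⟩ := Finset.card_pos.1 (show 0 < (Om n (k + 1) (ℓ - 1 - (k + 1)) ℓ 0).card by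
      exact_mod_cast Om_pos hl hrr hln (Nat.zero_le _))
    obtain ⟨g0, g1, _⟩ := mem_Tset.1 hM
    have h1 : charVec M ∈ matchingPolytope n ℓ :=
      subset_convexHull ℝ _ ⟨M, g0, by omega, rfl⟩
    rw [← hp] at h1
    obtain ⟨y, hy, _⟩ := h1
    exact ⟨y, hy⟩
  obtain ⟨I, h, hQI, hτ⟩ := normalized_system Aeq beq A b Q hQ hQne
  obtain ⟨s, hs1, hs2, hs3⟩ := section_lemma (G := Equiv.Perm (Fin n)) edgeAction edgeAction_mul
    edgeAction_inj Q p h hQI (by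
      intro π
      obtain ⟨U, u, hU, him, hpu⟩ := hsym π
      obtain ⟨τ, hτ⟩ := hτ U u hU him
      exact ⟨fun y => U.mulVec y + u, him, hpu, τ, hτ⟩)
  have hact : ∀ π, ∀ x ∈ p '' Q, edgeAction π x ∈ p '' Q := by
    rintro π _ ⟨y, hy, rfl⟩
    obtain ⟨U, u, hU, him, hpu⟩ := hsym π
    refine ⟨U.mulVec y + u, ?_, hpu y hy⟩
    rw [← him]; exact ⟨y, hy, rfl⟩
  have hact1 : ∀ x : Edge n → ℝ, edgeAction 1 x = x := by
    intro x
    funext e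
    simp only [edgeAction, inv_one, edgeMap_one]
  choose τ hτs using hs2
  rw [hp] at hs1 hs3 hact hτs
  refine no_section (r := k + 1) (by omega) hl hrr hln s hs1 hs3 ?_
  intro j
  let H : Subgroup (Equiv.Perm (Fin n)) :=
    { carrier := {π | ∀ x ∈ matchingPolytope n ℓ, s (edgeAction π x) j = s x j}
      mul_mem' := by
        intro π σ hπ hσ x hx
        rw [edgeAction_mul, hπ _ (hact σ x hx), hσ x hx]
      one_mem' := by
        intro x _
        rw [hact1]
      inv_mem' := by
        intro π hπ x hx
        have h1 := hπ _ (hact π⁻¹ x hx)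
        rw [← edgeAction_mul, mul_inv_cancel, hact1] at h1
        exact h1.symm }
  obtain ⟨U, hU, hC⟩ := hn₁ n hnn₁ I H (fun π => (τ π).symm j) (by
    intro π σ hπσ x hx
    have key : ∀ π x, x ∈ matchingPolytope n ℓ → s (edgeAction π x) j = s x ((τ π).symm j) := by
      intro π x hx
      have := hτs π x hx ((τ π).symm j)
      rwa [Equiv.apply_symm_apply] at this
    have h1 := key π _ (hact σ⁻¹ x hx)
    have h2 := key σ _ (hact σ⁻¹ x hx)
    rw [hπσ, ← h2, ← edgeAction_mul, ← edgeAction_mul, mul_inv_cancel, hact1] at h1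
    exact h1) (by
      rw [Fintype.card_coe]
      exact le_trans (by simpa using Finset.card_le_univ I) hfn)
  exact ⟨H, U, by omega, hC, fun ρ hρ x hx => hρ x hx⟩

end
end

section
/- Let a, b, c_1, …, c_r be positive integers with max{c_1,…,c_r} ≤ max{a,b} and ∑_{i=1}^r (c_i − 1) ≤ a + b − 2. Then ∏_{i=1}^r c_i! ≤ a! · b!. Moreover, if at least one of the two hypothesis inequalities is strict, then the conclusion holds with strict inequality. -/
open scoped BigOperators
open Nat

lemma aux_le (n k l : ℕ) : (n+k+1)! * (n+l+1)! ≤ (n+k+l+1)! * (n+1)! := by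
  induction k with
  | zero => simp [mul_comm]
  | succ k ih =>
    have e1 : (n+(k+1)+1)! = (n+k+2) * (n+k+1)! := Nat.factorial_succ (n+k+1)
    have e2 : (n+(k+1)+l+1)! = (n+k+l+2) * (n+k+l+1)! := by
      rw [show n+(k+1)+l+1 = (n+k+l+1)+1 by ring, Nat.factorial_succ]
    rw [e1, e2, mul_assoc, mul_assoc]
    exact Nat.mul_le_mul (by omega) ih

lemma aux_lt (n k l : ℕ) (hl : 0 < l) (hk : 0 < k) :
    (n+k+1)! * (n+l+1)! < (n+k+l+1)! * (n+1)! := by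
  obtain ⟨k, rfl⟩ : ∃ j, k = j + 1 := ⟨k - 1, by omega⟩
  have e1 : (n+(k+1)+1)! = (n+k+2) * (n+k+1)! := Nat.factorial_succ (n+k+1)
  have e2 : (n+(k+1)+l+1)! = (n+k+l+2) * (n+k+l+1)! := by
    rw [show n+(k+1)+l+1 = (n+k+l+1)+1 by ring, Nat.factorial_succ]
  rw [e1, e2, mul_assoc, mul_assoc]
  exact Nat.mul_lt_mul_of_lt_of_le (by omega) (aux_le n k l) (by positivity)

lemma aux_main {ι : Type*} (x : ι → ℕ) (s : Finset ι) : ∀ M N : ℕ, N ≤ M →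
    (∀ i ∈ s, x i ≤ M) → ∑ i ∈ s, x i ≤ M + N →
    (∏ i ∈ s, (x i + 1)!) ≤ (M+1)! * (N+1)! ∧
    (((∀ i ∈ s, x i < M) ∧ 0 < M ∨ ∑ i ∈ s, x i < M + N) →
      (∏ i ∈ s, (x i + 1)!) < (M+1)! * (N+1)!) := by
  classical
  induction s using Finset.induction_on with
  | empty =>
    intro M N hNM _ _
    have hM := Nat.factorial_pos (M+1)
    have hN := Nat.factorial_pos (N+1)
    simp only [Finset.prod_empty, Finset.sum_empty]
    refine ⟨Nat.mul_pos hM hN, fun h => ?_⟩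
    have h0 : 0 < M := by
      rcases h with h | h
      · exact h.2
      · omega
    have := Nat.self_le_factorial (M+1)
    nlinarith
  | insert j s hj ih =>
    intro M N hNM hx hs
    rw [Finset.sum_insert hj] at hs ⊢
    rw [Finset.prod_insert hj]
    have hjM := hx j (Finset.mem_insert_self j s)
    have hsM : ∀ i ∈ s, x i ≤ M := fun i hi => hx i (Finset.mem_insert_of_mem hi)
    by_cases hc : x j ≤ N
    · obtain ⟨d, rfl⟩ := Nat.exists_eq_add_of_le hc
      obtain ⟨i1, i2⟩ := ih M d (by omega) hsM (by omega)
      have h := aux_le 0 (x j) d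
      simp only [Nat.zero_add, Nat.factorial_one, Nat.mul_one] at h
      have h' : (x j + 1)! * ((M+1)! * (d+1)!) ≤ (M+1)! * (x j + d + 1)! := by
        calc _ = (M+1)! * ((x j + 1)! * (d+1)!) := by ring
          _ ≤ _ := Nat.mul_le_mul_left _ h
      refine ⟨(Nat.mul_le_mul_left _ i1).trans h', fun hst => ?_⟩
      refine lt_of_lt_of_le (Nat.mul_lt_mul_of_pos_left (i2 ?_) (Nat.factorial_pos _)) h'
      rcases hst with hst | hst
      · exact Or.inl ⟨fun i hi => hst.1 i (Finset.mem_insert_of_mem hi), hst.2⟩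
      · right; omega
    · obtain ⟨k, hk⟩ := Nat.exists_eq_add_of_le (show N ≤ x j by omega)
      obtain ⟨l, hl⟩ := Nat.exists_eq_add_of_le hjM
      have hle : ∀ i ∈ s, x i ≤ N + l := fun i hi => by
        have := Finset.single_le_sum (f := x) (fun _ _ => Nat.zero_le _) hi
        omega
      obtain ⟨i1, i2⟩ := ih (N+l) 0 (by omega) hle (by omega)
      simp only [Nat.zero_add, Nat.factorial_one, Nat.mul_one] at i1 i2
      have hM : M = N + k + l := by omega
      have h := aux_le N k l
      rw [← hM, ← hk] at h
      refine ⟨(Nat.mul_le_mul_left _ i1).trans h, fun hst => ?_⟩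
      rcases hst with hst | hst
      · have hlt := hst.1 j (Finset.mem_insert_self j s)
        have h2 := aux_lt N k l (by omega) (by omega)
        rw [← hM, ← hk] at h2
        exact lt_of_le_of_lt (Nat.mul_le_mul_left _ i1) h2
      · exact lt_of_lt_of_le
          (Nat.mul_lt_mul_of_pos_left (i2 (Or.inr (by omega))) (Nat.factorial_pos _)) h

lemma aux_wlog (r a b : ℕ) (hr : 0 < r) (hb : 0 < b) (hab : b ≤ a)
    (c : Fin r → ℕ) (hc : ∀ i, 0 < c i)
    (h1 : (Finset.univ.sup c) ≤ a)
    (h2 : ∑ i, (c i - 1) ≤ a + b - 2) :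
    (∏ i, (c i)!) ≤ a ! * b ! ∧
      (((Finset.univ.sup c) < a ∨ ∑ i, (c i - 1) < a + b - 2) →
        (∏ i, (c i)!) < a ! * b !) := by
  have hle : ∀ i, c i ≤ Finset.univ.sup c := fun i => Finset.le_sup (Finset.mem_univ i)
  obtain ⟨m1, m2⟩ := aux_main (fun i => c i - 1) Finset.univ (a-1) (b-1) (by omega)
    (fun i _ => by have := hle i; show c i - 1 ≤ a - 1; omega) (by omega)
  have e : ∀ i, c i - 1 + 1 = c i := fun i => by have := hc i; omega
  simp only [e, show a - 1 + 1 = a by omega, show b - 1 + 1 = b by omega] at m1 m2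
  refine ⟨m1, fun h => m2 ?_⟩
  rcases h with h | h
  · left
    refine ⟨fun i _ => ?_, ?_⟩
    · have := hle i
      have := hc i
      omega
    · have := hle ⟨0, hr⟩
      have := hc ⟨0, hr⟩
      omega
  · right; omega

/-- Lemma 3.5.  For positive integers `a, b, c_1, …, c_r` (`r ≥ 1`, so
that `max{c_1,…,c_r}` is well defined) with `max{c_1,…,c_r} ≤ max{a,b}` and
`∑ (c_i − 1) ≤ a + b − 2`, one has `∏ c_i! ≤ a!·b!`; and if one of the two hypothesis
inequalities is strict then the conclusion is strict as well. -/
theorem statement8 (r a b : ℕ) (hr : 0 < r) (ha : 0 < a) (hb : 0 < b)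
    (c : Fin r → ℕ) (hc : ∀ i, 0 < c i)
    (h1 : (Finset.univ.sup c) ≤ max a b)
    (h2 : ∑ i, (c i - 1) ≤ a + b - 2) :
    (∏ i, (c i)!) ≤ a ! * b ! ∧
      (((Finset.univ.sup c) < max a b ∨ ∑ i, (c i - 1) < a + b - 2) →
        (∏ i, (c i)!) < a ! * b !) := by
  rcases le_total b a with hab | hab
  · rw [max_eq_left hab] at h1 ⊢
    exact aux_wlog r a b hr hb hab c hc h1 h2
  · rw [max_eq_right hab] at h1 ⊢
    rw [add_comm a b] at h2 ⊢
    rw [mul_comm (a !)]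
    exact aux_wlog r b a hr ha hab c hc h1 h2
end
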